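/- (Chan-Liaw's Theorem, level 3.) Let p > 3 be a prime, and write (p+1)/3 = n/d in lowest terms, where n is the numerator and d the denominator of the reduced fraction, and set h = 6/d. Then there exists a nonzero polynomial P(X,Y) with real coefficients, of degree at most n in X and degree at most n in Y, such that for every real q with 0 < q < 1, P(u(q), v(q)) = 0, where beta = x_3(q), alpha = x_3(q^p), u(q) = (alpha*beta)^{1/h} and v(q) = ((1-alpha)(1-beta))^{1/h} (real h-th roots of the positive quantities alpha*beta and (1-alpha)(1-beta)). -/

import Mathlib

/-- The level-3 modular function `x₃(q) = 27q / (27q + ∏_{n≥1} (1+qⁿ+q²ⁿ)⁻¹²)`. -/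
noncomputable def x₃ (q : ℝ) : ℝ :=
  27 * q / (27 * q + ∏' n : ℕ, (1 + q ^ (n + 1) + q ^ (2 * (n + 1))) ^ (-12 : ℤ))

open Polynomial in
/-- Over a unique factorization domain, an irreducible polynomial of positive degree that does not
divide `f` generates together with `f` an ideal containing a nonzero constant. -/
lemma exists_C_eq_add_of_irreducible_of_not_dvd {A : Type*} [CommRing A] [IsDomain A]
    [NormalizedGCDMonoid A] {r f : A[X]} (hr : Irreducible r) (hdeg : r.natDegree ≠ 0)
    (hf : ¬ r ∣ f) : ∃ c : A, c ≠ 0 ∧ ∃ a b : A[X], C c = a * r + b * f := by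
  have hprim := hr.isPrimitive hdeg
  set K := FractionRing A
  have hirr := (hprim.irreducible_iff_irreducible_map_fraction_map (K := K)).mp hr
  have hnd : ¬ r.map (algebraMap A K) ∣ f.map (algebraMap A K) := fun h =>
    hf (hprim.dvd_of_fraction_map_dvd_fraction_map (K := K) h)
  obtain ⟨a, b, hab⟩ := (hirr.coprime_iff_not_dvd).mpr hnd
  obtain ⟨s, hs, hsa⟩ := IsLocalization.integerNormalization_spec (nonZeroDivisors A) a
  obtain ⟨t, ht, htb⟩ := IsLocalization.integerNormalization_spec (nonZeroDivisors A) b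
  refine ⟨s * t, mul_ne_zero (nonZeroDivisors.ne_zero hs) (nonZeroDivisors.ne_zero ht),
    C t * IsLocalization.integerNormalization (nonZeroDivisors A) a,
    C s * IsLocalization.integerNormalization (nonZeroDivisors A) b, ?_⟩
  apply Polynomial.map_injective _ (IsFractionRing.injective A K)
  simp only [Polynomial.map_add, Polynomial.map_mul, map_C, hsa, htb, map_mul]
  rw [← algebraMap_smul K s a, ← algebraMap_smul K t b, smul_eq_C_mul, smul_eq_C_mul]
  linear_combination (- C (algebraMap A K s) * C (algebraMap A K t)) * hab

open MvPolynomial in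
/-- A prime ideal of `k[X, Y]` without nonzero elements depending on `Y` only, containing nonzero
elements of degree at most `n` in each variable separately, contains one that has degree at most
`n` in both variables. -/
lemma exists_mem_degreeOf_le_of_prime {k : Type*} [Field k] {I : Ideal (MvPolynomial (Fin 2) k)}
    [hI : I.IsPrime] {n : ℕ} (hY : ∀ P ∈ I, P.degreeOf 0 = 0 → P = 0)
    (h0 : ∃ P ∈ I, P ≠ 0 ∧ P.degreeOf 0 ≤ n) (h1 : ∃ P ∈ I, P ≠ 0 ∧ P.degreeOf 1 ≤ n) :
    ∃ P ∈ I, P ≠ 0 ∧ P.degreeOf 0 ≤ n ∧ P.degreeOf 1 ≤ n := by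
  obtain ⟨P, hPI, hP0, hPn⟩ := h0
  obtain ⟨Q, hQI, hQ0, hQn⟩ := h1
  obtain ⟨S, hS, hSP⟩ := UniqueFactorizationMonoid.exists_prime_factors P hP0
  have hSI : S.prod ∈ I := by
    obtain ⟨w, hw⟩ := hSP.symm
    rw [← hw]
    exact I.mul_mem_right _ hPI
  obtain ⟨R, hRS, hRI⟩ := (hI.multiset_prod_mem_iff_exists_mem S).mp hSI
  have hRprime := hS R hRS
  have hRP : R ∣ P := (Multiset.dvd_prod hRS).trans hSP.dvd
  have hRQ : R ∣ Q := by
    by_contra hnd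
    set e := finSuccEquiv k 1
    let _ : NormalizedGCDMonoid (MvPolynomial (Fin 1) k) := Classical.choice
      (inferInstance : Nonempty (NormalizedGCDMonoid (MvPolynomial (Fin 1) k)))
    have hdeg : (e R).natDegree ≠ 0 := by
      rw [natDegree_finSuccEquiv]
      exact fun h => hRprime.ne_zero (hY R hRI h)
    obtain ⟨c, hc, a, b, hab⟩ := exists_C_eq_add_of_irreducible_of_not_dvd
      ((MulEquiv.irreducible_iff e).mpr hRprime.irreducible) hdeg
      (f := e Q) (fun h => hnd ((map_dvd_iff e).mp h))
    have hmem : e.symm (Polynomial.C c) ∈ I := by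
      rw [hab, map_add, map_mul, map_mul, e.symm_apply_apply, e.symm_apply_apply]
      exact I.add_mem (I.mul_mem_left _ hRI) (I.mul_mem_left _ hQI)
    have := hY _ hmem (by
      rw [← natDegree_finSuccEquiv]
      change (e (e.symm _)).natDegree = 0
      rw [e.apply_symm_apply, Polynomial.natDegree_C])
    rw [map_eq_zero_iff _ e.symm.injective, Polynomial.C_eq_zero] at this
    exact hc this
  refine ⟨R, hRI, hRprime.ne_zero, ?_, ?_⟩
  · obtain ⟨P', rfl⟩ := hRP
    rw [degreeOf_mul_eq (left_ne_zero_of_mul hP0) (right_ne_zero_of_mul hP0)] at hPn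
    lia
  · obtain ⟨Q', rfl⟩ := hRQ
    rw [degreeOf_mul_eq (left_ne_zero_of_mul hQ0) (right_ne_zero_of_mul hQ0)] at hQn
    lia

section CubicModularForms

open Complex Filter Topology ModularForm

/-- A holomorphic function on the upper half-plane, invariant under `τ ↦ τ + 1` and
`τ ↦ -1/(Nτ)` with `1 ≤ N ≤ 3`, takes all its values on `Im τ ≥ 1/4`. -/
lemma exists_quarter_le_im_eq {N : ℝ} (hN : 0 < N) (hN3 : N ≤ 3) {g : ℂ → ℂ}
    (hT : ∀ τ : ℂ, 0 < τ.im → g (τ + 1) = g τ)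
    (hW : ∀ τ : ℂ, 0 < τ.im → g (-1 / (N * τ)) = g τ) (τ : ℂ) (hτ : 0 < τ.im) :
    ∃ τ' : ℂ, 1 / 4 ≤ τ'.im ∧ |τ'.re| ≤ 1 / 2 ∧ g τ' = g τ := by
  have hTn : ∀ (n : ℕ) (τ : ℂ), 0 < τ.im → g (τ + n) = g τ := by
    intro n
    induction n with
    | zero => simp
    | succ n ih =>
      intro τ hτ
      rw [← ih τ hτ, ← hT (τ + n) (by simpa using hτ)]
      push_cast
      ring_nf
  have hTz : ∀ (n : ℤ) (τ : ℂ), 0 < τ.im → g (τ + n) = g τ := by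
    intro n τ hτ
    obtain ⟨n, rfl | rfl⟩ := n.eq_nat_or_neg
    · exact_mod_cast hTn n τ hτ
    · rw [← hTn n (τ + _) (by simpa using hτ)]
      simp
  have hred : ∀ τ : ℂ, 0 < τ.im → ∃ τ' : ℂ, τ'.im = τ.im ∧ |τ'.re| ≤ 1 / 2 ∧ g τ' = g τ := by
    intro τ hτ
    refine ⟨τ + ((-round τ.re : ℤ) : ℂ), by simp, ?_, hTz _ τ hτ⟩
    simpa [← sub_eq_add_neg] using abs_sub_round τ.re
  have key : ∀ n : ℕ, ∀ τ : ℂ, 0 < τ.im → 1 / 4 * (15 / 16 : ℝ) ^ n ≤ τ.im →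
      ∃ τ' : ℂ, 1 / 4 ≤ τ'.im ∧ |τ'.re| ≤ 1 / 2 ∧ g τ' = g τ := by
    intro n
    induction n with
    | zero =>
      intro τ hτ h
      obtain ⟨τ', h1, h2, h3⟩ := hred τ hτ
      exact ⟨τ', by rw [h1]; simpa using h, h2, h3⟩
    | succ n ih =>
      intro τ hτ h
      obtain ⟨τ', h1, h2, h3⟩ := hred τ hτ
      rcases le_or_gt (1 / 4) τ.im with h4 | h4
      · exact ⟨τ', by rwa [h1], h2, h3⟩
      have hns : normSq τ' ≤ 5 / 16 := by
        rw [normSq_apply, h1]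
        nlinarith [abs_le.mp h2]
      have hpos : 0 < normSq τ' := by
        rw [normSq_pos]
        rintro rfl
        simp at h1
        linarith
      have him : (-1 / (N * τ')).im = τ.im / (N * normSq τ') := by
        rw [show -1 / (N * τ') = (((-N⁻¹ : ℝ)) : ℂ) * τ'⁻¹ by
          push_cast; rw [neg_mul, ← mul_inv]; ring, im_ofReal_mul, inv_im, h1]
        field_simp
      have him' : 16 / 15 * τ.im ≤ (-1 / (N * τ')).im := by
        rw [him, le_div_iff₀ (by positivity)]
        have : N * normSq τ' ≤ 15 / 16 := by nlinarith
        nlinarith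
      obtain ⟨τ'', h5, h6, h7⟩ := ih (-1 / (N * τ')) (by linarith) (by
        rw [pow_succ] at h
        linarith)
      exact ⟨τ'', h5, h6, by rw [h7, hW _ (by rwa [h1]), h3]⟩
  obtain ⟨n, hn⟩ := exists_pow_lt_of_lt_one hτ (show (15 / 16 : ℝ) < 1 by norm_num)
  exact key n τ hτ (by nlinarith [show (0 : ℝ) < (15 / 16) ^ n by positivity])

/-- Maximum principle for the group generated by `τ ↦ τ + 1` and `τ ↦ -1/(Nτ)`. -/
lemma eq_zero_of_fricke_invariant {N : ℝ} (hN : 0 < N) (hN3 : N ≤ 3) {g : ℂ → ℂ}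
    (hg : DifferentiableOn ℂ g {τ | 0 < τ.im})
    (hT : ∀ τ : ℂ, 0 < τ.im → g (τ + 1) = g τ)
    (hW : ∀ τ : ℂ, 0 < τ.im → g (-1 / (N * τ)) = g τ)
    (hlim : Tendsto g (comap im atTop) (𝓝 0)) (τ : ℂ) (hτ : 0 < τ.im) : g τ = 0 := by
  by_contra h0
  have hpos : 0 < ‖g τ‖ := norm_pos_iff.mpr h0
  have hev : ∀ᶠ z in comap im atTop, ‖g z‖ < ‖g τ‖ := by
    have := hlim.norm
    rw [norm_zero] at this
    exact this.eventually_lt_const hpos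
  rw [eventually_comap, eventually_atTop] at hev
  obtain ⟨Y, hY⟩ := hev
  set K : Set ℂ := Set.Icc (-(1 / 2) : ℝ) (1 / 2) ×ℂ Set.Icc (1 / 4) Y with hK
  have hKc : IsCompact K := isCompact_Icc.reProdIm isCompact_Icc
  obtain ⟨τ', h1, h2, h3⟩ := exists_quarter_le_im_eq hN hN3 hT hW τ hτ
  have hlow : ∀ z : ℂ, ‖g τ‖ ≤ ‖g z‖ → z.im ≤ Y := fun z hz => by
    by_contra hlt
    exact absurd (hY z.im (not_le.mp hlt).le z rfl) (not_lt.mpr hz)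
  have hτ'K : τ' ∈ K := by
    rw [hK, mem_reProdIm]
    exact ⟨abs_le.mp h2, h1, hlow τ' (by rw [h3])⟩
  have hKH : K ⊆ {τ | 0 < τ.im} := fun z hz => by
    rw [hK, mem_reProdIm] at hz
    exact lt_of_lt_of_le (by norm_num) hz.2.1
  obtain ⟨z, hzK, hz⟩ := hKc.exists_isMaxOn ⟨τ', hτ'K⟩ (hg.continuousOn.norm.mono hKH)
  have hzτ : ‖g τ‖ ≤ ‖g z‖ := by simpa [h3] using hz hτ'K
  have hmax : IsMaxOn (norm ∘ g) {τ | 0 < τ.im} z := by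
    intro w hw
    obtain ⟨w', k1, k2, k3⟩ := exists_quarter_le_im_eq hN hN3 hT hW w hw
    change ‖g w‖ ≤ ‖g z‖
    by_contra hlt
    have hwK : w' ∈ K := by
      rw [hK, mem_reProdIm]
      exact ⟨abs_le.mp k2, k1, hlow w' (by rw [k3]; linarith)⟩
    have := hz hwK
    simp only [Set.mem_ofPred_eq, k3] at this
    exact hlt this
  have hconst := eqOn_of_isPreconnected_of_isMaxOn_norm
    (convex_halfSpace_im_gt 0).isPreconnected (isOpen_lt continuous_const continuous_im)
    hg (hKH hzK) hmax
  have := hconst (show (((|Y| + 1 : ℝ) : ℂ) * I) ∈ {τ : ℂ | 0 < τ.im} by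
    simp; positivity)
  have h5 := hlow (((|Y| + 1 : ℝ) : ℂ) * I) (by rw [this]; exact hzτ)
  have h6 : (((|Y| + 1 : ℝ) : ℂ) * I).im = |Y| + 1 := by simp
  linarith [le_abs_self Y]

lemma HasSum.int_even_add_odd {M : Type*} [AddCommMonoid M] [TopologicalSpace M] [ContinuousAdd M]
    {f : ℤ → M} {a b : M} (he : HasSum (fun n => f (2 * n)) a)
    (ho : HasSum (fun n => f (2 * n + 1)) b) : HasSum f (a + b) := by
  have h2 := mul_right_injective₀ (two_ne_zero' ℤ)
  replace ho := ((add_left_injective 1).comp h2).hasSum_range_iff.2 ho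
  refine (h2.hasSum_range_iff.2 he).add_isCompl ?_ ho
  have hodd : Set.range ((fun n : ℤ => n + 1) ∘ fun n => 2 * n) = {n | Odd n} := by
    ext n
    simp only [Set.mem_range, Function.comp_apply, Set.mem_ofPred_eq, Odd, eq_comm]
  rw [hodd]
  simpa using Int.isCompl_even_odd

/-- The odd part of the theta series has a simple behaviour under `τ ↦ τ + 1 / 2`. -/
lemma jacobiTheta_add_half {τ : ℂ} (hτ : 0 < τ.im) :
    jacobiTheta (τ + 1 / 2) = jacobiTheta (4 * τ) + I * (jacobiTheta τ - jacobiTheta (4 * τ)) := by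
  have hs : ∀ σ : ℂ, 0 < σ.im →
      HasSum (fun n : ℤ => cexp (Real.pi * I * (n : ℂ) ^ 2 * σ)) (jacobiTheta σ) := by
    intro σ hσ
    have := hasSum_jacobiTheta₂_term 0 hσ
    rw [← jacobiTheta_eq_jacobiTheta₂] at this
    simpa [jacobiTheta₂_term] using this
  have heven : HasSum (fun n : ℤ => cexp (Real.pi * I * ((2 * n : ℤ) : ℂ) ^ 2 * τ))
      (jacobiTheta (4 * τ)) := by
    convert hs (4 * τ) (by simpa using hτ) using 3 with n
    push_cast
    ring
  have hodd : HasSum (fun n : ℤ => cexp (Real.pi * I * ((2 * n + 1 : ℤ) : ℂ) ^ 2 * τ))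
      (jacobiTheta τ - jacobiTheta (4 * τ)) := by
    have hsum : Summable fun n : ℤ => cexp (Real.pi * I * ((2 * n + 1 : ℤ) : ℂ) ^ 2 * τ) :=
      (hs τ hτ).summable.comp_injective (i := fun n : ℤ => 2 * n + 1) fun a b h => by
        simpa using h
    have := (HasSum.int_even_add_odd (f := fun n : ℤ => cexp (Real.pi * I * (n : ℂ) ^ 2 * τ))
      heven hsum.hasSum).unique (hs τ hτ)
    rw [← this, add_sub_cancel_left]
    exact hsum.hasSum
  have he : ∀ n : ℤ, cexp (Real.pi * I * ((2 * n : ℤ) : ℂ) ^ 2 * (τ + 1 / 2)) =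
      cexp (Real.pi * I * ((2 * n : ℤ) : ℂ) ^ 2 * τ) := by
    intro n
    rw [mul_add, Complex.exp_add]
    refine (mul_right_eq_self₀.mpr (Or.inl ?_))
    rw [Complex.exp_eq_one_iff]
    exact ⟨n ^ 2, by push_cast; ring⟩
  have ho : ∀ n : ℤ, cexp (Real.pi * I * ((2 * n + 1 : ℤ) : ℂ) ^ 2 * (τ + 1 / 2)) =
      I * cexp (Real.pi * I * ((2 * n + 1 : ℤ) : ℂ) ^ 2 * τ) := by
    intro n
    rw [mul_add, Complex.exp_add, mul_comm]
    congr 1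
    have : (Real.pi : ℂ) * I * ((2 * n + 1 : ℤ) : ℂ) ^ 2 * (1 / 2)
        = Real.pi / 2 * I + (n ^ 2 + n : ℤ) * (2 * Real.pi * I) := by
      push_cast
      ring
    rw [this, Complex.exp_add, Complex.exp_pi_div_two_mul_I, Complex.exp_int_mul_two_pi_mul_I,
      mul_one]
  refine (hs (τ + 1 / 2) (by simpa using hτ)).unique (HasSum.int_even_add_odd
    (f := fun n : ℤ => cexp (Real.pi * I * (n : ℂ) ^ 2 * (τ + 1 / 2))) ?_ ?_)
  · simp only [he]
    exact heven
  · simp only [ho]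
    exact hodd.mul_left I

lemma jacobiTheta_neg_inv {τ : ℂ} (hτ : 0 < τ.im) :
    jacobiTheta (-1 / τ) = (-I * τ) ^ (1 / 2 : ℂ) * jacobiTheta τ := by
  have := jacobiTheta_S_smul ⟨τ, hτ⟩
  rw [UpperHalfPlane.modular_S_smul] at this
  simpa [neg_div, inv_neg] using this

lemma jacobiTheta_neg_inv_mul {r : ℝ} (hr : 0 < r) {τ : ℂ} (hτ : 0 < τ.im) :
    jacobiTheta (-1 / (r * τ)) =
      (√r : ℝ) * (-I * τ) ^ (1 / 2 : ℂ) * jacobiTheta (r * τ) := by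
  have h0 : -I * τ ≠ 0 := by
    rw [mul_ne_zero_iff]
    exact ⟨by simp, fun h => by simp [h] at hτ⟩
  have hr0 : (r : ℂ) ≠ 0 := by exact_mod_cast hr.ne'
  rw [jacobiTheta_neg_inv (by simpa [hr] using hτ),
    show -I * (r * τ) = r * (-I * τ) by ring, cpow_def_of_ne_zero (mul_ne_zero hr0 h0),
    cpow_def_of_ne_zero h0, log_ofReal_mul hr h0, add_mul, Complex.exp_add,
    Real.sqrt_eq_rpow, Real.rpow_def_of_pos hr]
  push_cast
  ring

/-- The cubic theta function `∑ q ^ (m² + mn + n²)`, in terms of Jacobi's theta function. -/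
noncomputable def cubicTheta (τ : ℂ) : ℂ :=
  jacobiTheta (2 * τ) * jacobiTheta (6 * τ) +
    (jacobiTheta (τ / 2) - jacobiTheta (2 * τ)) * (jacobiTheta (3 * τ / 2) - jacobiTheta (6 * τ))

lemma cubicTheta_add_one {τ : ℂ} (hτ : 0 < τ.im) : cubicTheta (τ + 1) = cubicTheta τ := by
  have h2 : ∀ σ, jacobiTheta (σ + 2) = jacobiTheta σ := fun σ => by
    rw [add_comm, jacobiTheta_two_add]
  have h1 := jacobiTheta_add_half (τ := τ / 2) (by simpa using hτ)
  have h3 := jacobiTheta_add_half (τ := 3 * τ / 2) (by simpa using hτ)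
  have h4 := jacobiTheta_add_half (τ := 3 * τ / 2 + 1 / 2) (by simpa using hτ)
  rw [show τ / 2 + 1 / 2 = (τ + 1) / 2 by ring, show 4 * (τ / 2) = 2 * τ by ring] at h1
  rw [show 4 * (3 * τ / 2) = 6 * τ by ring] at h3
  have h5 := jacobiTheta_add_half (τ := 3 * τ / 2 + 1) (by simpa using hτ)
  rw [show 3 * τ / 2 + 1 / 2 + 1 / 2 = 3 * τ / 2 + 1 by ring,
    show 4 * (3 * τ / 2 + 1 / 2) = 6 * τ + 2 by ring, h2] at h4
  rw [show 3 * τ / 2 + 1 + 1 / 2 = 3 * (τ + 1) / 2 by ring,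
    show 4 * (3 * τ / 2 + 1) = 6 * τ + 2 + 2 by ring, h2, h2] at h5
  rw [cubicTheta, cubicTheta, h1, h5, h4, h3, show 2 * (τ + 1) = 2 * τ + 2 by ring,
    show 6 * (τ + 1) = 6 * τ + 2 + 2 + 2 by ring, h2, h2, h2, h2]
  linear_combination (jacobiTheta (τ / 2) - jacobiTheta (2 * τ)) *
    (jacobiTheta (3 * τ / 2) - jacobiTheta (6 * τ)) * I_pow_four

lemma cubicTheta_fricke {τ : ℂ} (hτ : 0 < τ.im) :
    cubicTheta (-1 / (3 * τ)) = (√3 : ℝ) * (-I * τ) * cubicTheta τ := by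
  have hτ0 : τ ≠ 0 := fun h => by simp [h] at hτ
  have h1 := jacobiTheta_neg_inv_mul (r := 3 / 2) (by norm_num) hτ
  have h2 := jacobiTheta_neg_inv_mul (r := 1 / 2) (by norm_num) hτ
  have h3 := jacobiTheta_neg_inv_mul (r := 6) (by norm_num) hτ
  have h4 := jacobiTheta_neg_inv_mul (r := 2) (by norm_num) hτ
  have hA : ((-I * τ) ^ (1 / 2 : ℂ)) ^ 2 = -I * τ := by
    rw [← cpow_nat_mul]
    simp
  set A := (-I * τ) ^ (1 / 2 : ℂ)
  have e1 : √(3 / 2 : ℝ) = √3 / √2 := Real.sqrt_div (by norm_num) _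
  have e2 : √(1 / 2 : ℝ) = 1 / √2 := by rw [Real.sqrt_div (by norm_num), Real.sqrt_one]
  have e3 : √(6 : ℝ) = √3 * √2 := by rw [← Real.sqrt_mul (by norm_num)]; norm_num
  have e4 : ((√2 : ℝ) : ℂ) ^ 2 = 2 := by norm_cast; simp
  have e5 : ((√2 : ℝ) : ℂ) ≠ 0 := by norm_cast; simp
  rw [e1] at h1
  rw [e2] at h2
  rw [e3] at h3
  push_cast at h1 h2 h3 h4
  rw [cubicTheta, cubicTheta, show 2 * (-1 / (3 * τ)) = -1 / (3 / 2 * τ) by field_simp,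
    show 6 * (-1 / (3 * τ)) = -1 / (1 / 2 * τ) by field_simp; ring,
    show -1 / (3 * τ) / 2 = -1 / (6 * τ) by field_simp; ring,
    show 3 * (-1 / (3 * τ)) / 2 = -1 / (2 * τ) by field_simp, h1, h2, h3, h4,
    show (3 : ℂ) / 2 * τ = 3 * τ / 2 by ring, show (1 : ℂ) / 2 * τ = τ / 2 by ring, ← hA]
  field_simp
  rw [e4]
  ring

/-- The Euler product `∏ (1 - qⁿ)`. -/
noncomputable def eulerProd (q : ℂ) : ℂ := ∏' n : ℕ, (1 - q ^ (n + 1))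

lemma eulerProd_zero : eulerProd 0 = 1 := by simp [eulerProd]

lemma differentiableAt_eulerProd {q : ℂ} (hq : ‖q‖ < 1) : DifferentiableAt ℂ eulerProd q :=
  differentiableOn_tprod_one_sub_pow.differentiableAt
    (Metric.isOpen_ball.mem_nhds (by simpa using hq))

lemma eta_eq_mul_eulerProd (τ : ℂ) :
    η τ = cexp (2 * Real.pi * I * τ / 24) * eulerProd (cexp (2 * Real.pi * I * τ)) := by
  simp [ModularForm.eta, eulerProd, eta_q, Function.Periodic.qParam]

lemma eta_add_one (τ : ℂ) : η (τ + 1) = cexp (2 * Real.pi * I / 24) * η τ := by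
  rw [eta_eq_mul_eulerProd, eta_eq_mul_eulerProd,
    show 2 * Real.pi * I * (τ + 1) = 2 * Real.pi * I * τ + 2 * Real.pi * I by ring,
    Complex.exp_periodic, add_div, Complex.exp_add]
  ring

lemma eta_neg_inv {τ : ℂ} (hτ : 0 < τ.im) :
    η (-1 / τ) = (sqrt I)⁻¹ * (sqrt τ * η τ) := by
  simpa using eta_comp_eq_csqrt_I_inv hτ

lemma eta_ne_zero_of_im_pos {τ : ℂ} (hτ : 0 < τ.im) : η τ ≠ 0 := eta_ne_zero hτ

lemma sqrt_three_sq : (((√3 : ℝ) : ℂ)) ^ 2 = 3 := by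
  norm_cast
  simp

/-- `√3 (η(3τ)/η(τ))²`, a Hauptmodul of level 3 up to a sixth root of unity. -/
noncomputable def cubicS (τ : ℂ) : ℂ := (√3 : ℝ) * (η (3 * τ) / η τ) ^ 2

/-- `a(q)/b(q)` in terms of the cubic theta functions. -/
noncomputable def cubicE (τ : ℂ) : ℂ := cubicTheta τ * η (3 * τ) / η τ ^ 3

lemma cubicS_ne_zero {τ : ℂ} (hτ : 0 < τ.im) : cubicS τ ≠ 0 := by
  have h1 := eta_ne_zero_of_im_pos hτ
  have h2 := eta_ne_zero_of_im_pos (τ := 3 * τ) (by simpa using hτ)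
  simp [cubicS, h1, h2]

lemma cubicS_add_one (τ : ℂ) :
    cubicS (τ + 1) = cexp (Real.pi * I / 3) * cubicS τ := by
  have h : (cexp (2 * Real.pi * I / 24)) ≠ 0 := Complex.exp_ne_zero _
  have h1 : cexp (Real.pi * I / 3) = cexp (2 * Real.pi * I / 24) ^ 4 := by
    rw [← Complex.exp_nat_mul]
    congr 1
    push_cast
    ring
  rw [cubicS, cubicS, show 3 * (τ + 1) = 3 * τ + 1 + 1 + 1 by ring, eta_add_one, eta_add_one,
    eta_add_one, eta_add_one, h1, mul_div_mul_left _ _ h]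
  ring

lemma cubicE_add_one {τ : ℂ} (hτ : 0 < τ.im) : cubicE (τ + 1) = cubicE τ := by
  have h : (cexp (2 * Real.pi * I / 24)) ≠ 0 := Complex.exp_ne_zero _
  have h1 := eta_ne_zero_of_im_pos hτ
  rw [cubicE, cubicE, show 3 * (τ + 1) = 3 * τ + 1 + 1 + 1 by ring, eta_add_one, eta_add_one,
    eta_add_one, eta_add_one, cubicTheta_add_one hτ]
  field_simp

lemma exists_eta_fricke {τ : ℂ} (hτ : 0 < τ.im) : ∃ A : ℂ, A ^ 2 = -I * τ ∧
    η (-1 / (3 * τ)) = (√3 : ℝ) * A * η (3 * τ) ∧ η (3 * (-1 / (3 * τ))) = A * η τ := by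
  have hτ0 : τ ≠ 0 := fun h => by simp [h] at hτ
  have hsq {z : ℂ} (hz : z ≠ 0) : sqrt z ^ 2 = z := by
    rw [sqrt_eq_exp hz, ← Complex.exp_nat_mul, Nat.cast_ofNat, mul_div_cancel₀ _ two_ne_zero,
      exp_log hz]
  refine ⟨(sqrt I)⁻¹ * sqrt τ, ?_, ?_, ?_⟩
  · rw [mul_pow, inv_pow, hsq I_ne_zero, hsq hτ0, inv_I]
  · rw [eta_neg_inv (by simpa using hτ)]
    have : sqrt (3 * τ) = (√3 : ℝ) * sqrt τ := by
      have h3 := log_ofReal_mul (r := 3) (by norm_num) hτ0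
      push_cast at h3
      rw [sqrt_eq_exp (by simpa using hτ0), sqrt_eq_exp hτ0, h3, add_div, Complex.exp_add,
        Real.sqrt_eq_rpow, Real.rpow_def_of_pos (by norm_num)]
      push_cast
      ring_nf
    rw [this]
    ring
  · rw [show 3 * (-1 / (3 * τ)) = -1 / τ by field_simp, eta_neg_inv hτ]
    ring

lemma cubicS_fricke {τ : ℂ} (hτ : 0 < τ.im) : cubicS (-1 / (3 * τ)) = (cubicS τ)⁻¹ := by
  obtain ⟨A, hA, h1, h2⟩ := exists_eta_fricke hτ
  have hτ0 : τ ≠ 0 := fun h => by simp [h] at hτ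
  have hA0 : A ≠ 0 := fun h => by simp [h, hτ0] at hA
  have h3 := eta_ne_zero_of_im_pos hτ
  have h4 := eta_ne_zero_of_im_pos (τ := 3 * τ) (by simpa using hτ)
  have h5 : ((√3 : ℝ) : ℂ) ≠ 0 := by norm_cast; simp
  rw [cubicS, cubicS, h1, h2]
  field_simp

lemma cubicE_fricke {τ : ℂ} (hτ : 0 < τ.im) :
    cubicE (-1 / (3 * τ)) = cubicE τ / cubicS τ ^ 2 := by
  obtain ⟨A, hA, h1, h2⟩ := exists_eta_fricke hτ
  have hτ0 : τ ≠ 0 := fun h => by simp [h] at hτ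
  have hA0 : A ≠ 0 := fun h => by simp [h, hτ0] at hA
  have h3 := eta_ne_zero_of_im_pos hτ
  have h4 := eta_ne_zero_of_im_pos (τ := 3 * τ) (by simpa using hτ)
  have h5 : ((√3 : ℝ) : ℂ) ≠ 0 := by norm_cast; simp
  rw [cubicE, cubicE, cubicS, cubicTheta_fricke hτ, ← hA, h1, h2]
  field_simp

lemma differentiableAt_eta_mul {r : ℝ} (hr : 0 < r) {τ : ℂ} (hτ : 0 < τ.im) :
    DifferentiableAt ℂ (fun τ => η (r * τ)) τ :=
  DifferentiableAt.comp τ (g := η)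
    (differentiableAt_eta_of_mem_upperHalfPlaneSet
      (show 0 < ((r : ℂ) * τ).im by simpa [hr] using hτ)) (by fun_prop)

lemma differentiableAt_cubicS {τ : ℂ} (hτ : 0 < τ.im) : DifferentiableAt ℂ cubicS τ := by
  have h1 := differentiableAt_eta_mul (r := 3) (by norm_num) hτ
  have h2 := differentiableAt_eta_of_mem_upperHalfPlaneSet (z := τ) hτ
  push_cast at h1
  exact ((h1.div h2 (eta_ne_zero_of_im_pos hτ)).pow 2).const_mul _

lemma differentiableAt_jacobiTheta_mul {r : ℝ} (hr : 0 < r) {τ : ℂ} (hτ : 0 < τ.im) :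
    DifferentiableAt ℂ (fun τ => jacobiTheta (r * τ)) τ :=
  DifferentiableAt.comp τ (g := jacobiTheta)
    (differentiableAt_jacobiTheta (show 0 < ((r : ℂ) * τ).im by simpa [hr] using hτ)) (by fun_prop)

lemma cubicTheta_eq (τ : ℂ) : cubicTheta τ =
    jacobiTheta ((2 : ℝ) * τ) * jacobiTheta ((6 : ℝ) * τ) +
    (jacobiTheta ((1 / 2 : ℝ) * τ) - jacobiTheta ((2 : ℝ) * τ)) *
      (jacobiTheta ((3 / 2 : ℝ) * τ) - jacobiTheta ((6 : ℝ) * τ)) := by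
  rw [cubicTheta]
  push_cast
  rw [div_mul_eq_mul_div, div_mul_eq_mul_div, one_mul]

lemma differentiableAt_cubicTheta {τ : ℂ} (hτ : 0 < τ.im) : DifferentiableAt ℂ cubicTheta τ := by
  rw [funext cubicTheta_eq]
  have h (r : ℝ) (hr : 0 < r) := differentiableAt_jacobiTheta_mul hr hτ
  have h1 := h 2 (by norm_num)
  have h2 := h 6 (by norm_num)
  have h3 := h (1 / 2) (by norm_num)
  have h4 := h (3 / 2) (by norm_num)
  exact (h1.mul h2).add ((h3.sub h1).mul (h4.sub h2))

lemma differentiableAt_cubicE {τ : ℂ} (hτ : 0 < τ.im) : DifferentiableAt ℂ cubicE τ := by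
  have h1 := differentiableAt_eta_mul (r := 3) (by norm_num) hτ
  have h2 := differentiableAt_eta_of_mem_upperHalfPlaneSet (z := τ) hτ
  push_cast at h1
  exact ((differentiableAt_cubicTheta hτ).mul h1).div (h2.pow 3)
    (pow_ne_zero 3 (eta_ne_zero_of_im_pos hτ))

lemma tendsto_jacobiTheta_mul {r : ℝ} (hr : 0 < r) :
    Tendsto (fun τ => jacobiTheta (r * τ)) (comap im atTop) (𝓝 1) := by
  have h1 : Tendsto (fun τ => jacobiTheta τ - 1) (comap im atTop) (𝓝 0) := by
    refine isBigO_at_im_infty_jacobiTheta_sub_one.trans_tendsto ?_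
    refine Real.tendsto_exp_atBot.comp ?_
    exact tendsto_comap.const_mul_atTop_of_neg (by simp [Real.pi_pos])
  have h2 : Tendsto jacobiTheta (comap im atTop) (𝓝 1) := by
    simpa using h1.add_const 1
  refine h2.comp ?_
  rw [tendsto_comap_iff]
  have : im ∘ (fun τ : ℂ => (r : ℂ) * τ) = fun τ => r * τ.im := by ext; simp
  rw [this]
  exact tendsto_comap.const_mul_atTop hr

lemma tendsto_cubicTheta : Tendsto cubicTheta (comap im atTop) (𝓝 1) := by
  rw [funext cubicTheta_eq]
  have h1 := tendsto_jacobiTheta_mul (r := 2) (by norm_num)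
  have h2 := tendsto_jacobiTheta_mul (r := 6) (by norm_num)
  have h3 := tendsto_jacobiTheta_mul (r := 1 / 2) (by norm_num)
  have h4 := tendsto_jacobiTheta_mul (r := 3 / 2) (by norm_num)
  simpa using (h1.mul h2).add ((h3.sub h1).mul (h4.sub h2))

lemma tendsto_cexp_two_pi :
    Tendsto (fun τ : ℂ => cexp (2 * Real.pi * I * τ)) (comap im atTop) (𝓝 0) := by
  have := (Function.Periodic.qParam_tendsto one_pos).mono_right nhdsWithin_le_nhds
  refine this.congr fun τ => ?_
  simp [Function.Periodic.qParam]

lemma cubicS_eq (τ : ℂ) : cubicS τ = (√3 : ℝ) * cexp (Real.pi * I * τ / 3) *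
    (eulerProd (cexp (2 * Real.pi * I * τ) ^ 3) / eulerProd (cexp (2 * Real.pi * I * τ))) ^ 2 := by
  have h1 : cexp (2 * Real.pi * I * (3 * τ)) = cexp (2 * Real.pi * I * τ) ^ 3 := by
    rw [← Complex.exp_nat_mul]
    congr 1
    push_cast
    ring
  have h2 : cexp (Real.pi * I * τ / 3) = cexp (2 * Real.pi * I * τ / 24) ^ 4 := by
    rw [← Complex.exp_nat_mul]
    congr 1
    push_cast
    ring
  have h3 : cexp (2 * Real.pi * I * (3 * τ) / 24) = cexp (2 * Real.pi * I * τ / 24) ^ 3 := by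
    rw [← Complex.exp_nat_mul]
    congr 1
    push_cast
    ring
  have h4 : cexp (2 * Real.pi * I * τ / 24) ≠ 0 := Complex.exp_ne_zero _
  rw [cubicS, eta_eq_mul_eulerProd, eta_eq_mul_eulerProd, h1, h2, h3]
  rw [mul_div_mul_comm, show cexp (2 * Real.pi * I * τ / 24) ^ 3 / cexp (2 * Real.pi * I * τ / 24)
    = cexp (2 * Real.pi * I * τ / 24) ^ 2 by field_simp]
  ring

lemma cubicE_eq (τ : ℂ) : cubicE τ = cubicTheta τ *
    (eulerProd (cexp (2 * Real.pi * I * τ) ^ 3) / eulerProd (cexp (2 * Real.pi * I * τ)) ^ 3) := by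
  have h1 : cexp (2 * Real.pi * I * (3 * τ)) = cexp (2 * Real.pi * I * τ) ^ 3 := by
    rw [← Complex.exp_nat_mul]
    congr 1
    push_cast
    ring
  have h3 : cexp (2 * Real.pi * I * (3 * τ) / 24) = cexp (2 * Real.pi * I * τ / 24) ^ 3 := by
    rw [← Complex.exp_nat_mul]
    congr 1
    push_cast
    ring
  have h4 : cexp (2 * Real.pi * I * τ / 24) ≠ 0 := Complex.exp_ne_zero _
  rw [cubicE, eta_eq_mul_eulerProd, eta_eq_mul_eulerProd, h1, h3, mul_pow, mul_div_assoc,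
    mul_div_mul_left _ _ (pow_ne_zero 3 h4)]

lemma tendsto_eulerProd : Tendsto eulerProd (𝓝 0) (𝓝 1) := by
  have := (differentiableAt_eulerProd (q := 0) (by simp)).continuousAt.tendsto
  rwa [eulerProd_zero] at this

lemma tendsto_cubicE : Tendsto cubicE (comap im atTop) (𝓝 1) := by
  rw [funext cubicE_eq]
  have h := tendsto_cexp_two_pi
  have h1 := tendsto_eulerProd.comp h
  have h2 := tendsto_eulerProd.comp (by simpa using h.pow 3)
  simpa using tendsto_cubicTheta.mul (h2.div (h1.pow 3) (by simp))

lemma tendsto_cubicS_unit : Tendsto (fun τ : ℂ =>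
    (eulerProd (cexp (2 * Real.pi * I * τ) ^ 3) / eulerProd (cexp (2 * Real.pi * I * τ))) ^ 2)
    (comap im atTop) (𝓝 1) := by
  have h := tendsto_cexp_two_pi
  have h1 := tendsto_eulerProd.comp h
  have h2 := tendsto_eulerProd.comp (by simpa using h.pow 3)
  simpa using (h2.div h1 (by simp)).pow 2

lemma cexp_pi_mul_I_div_three_pow_six : cexp (Real.pi * I / 3) ^ 6 = 1 := by
  rw [← Complex.exp_nat_mul, ← Complex.exp_two_pi_mul_I]
  congr 1
  push_cast
  ring

lemma cexp_pi_mul_I_div_three_pow_three : cexp (Real.pi * I / 3) ^ 3 = -1 := by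
  rw [← Complex.exp_nat_mul, ← Complex.exp_pi_mul_I]
  congr 1
  push_cast
  ring

lemma cubicS_pow_six_eq (τ : ℂ) : cubicS τ ^ 6 = 27 * cexp (2 * Real.pi * I * τ) *
    (eulerProd (cexp (2 * Real.pi * I * τ) ^ 3) /
      eulerProd (cexp (2 * Real.pi * I * τ))) ^ 12 := by
  have h2 : cexp (2 * Real.pi * I * τ) = cexp (Real.pi * I * τ / 3) ^ 6 := by
    rw [← Complex.exp_nat_mul]
    congr 1
    push_cast
    ring
  rw [cubicS_eq, mul_pow, mul_pow, ← h2]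
  linear_combination ((cexp (2 * Real.pi * I * τ)) * (eulerProd (cexp (2 * Real.pi * I * τ) ^ 3) /
      eulerProd (cexp (2 * Real.pi * I * τ))) ^ 12) * ((((√3 : ℝ) : ℂ)) ^ 4 + 3 * (√3 : ℝ) ^ 2 + 9)
      * sqrt_three_sq

lemma tendsto_cubicS_pow_six : Tendsto (fun τ => cubicS τ ^ 6) (comap im atTop) (𝓝 0) := by
  simp_rw [cubicS_pow_six_eq]
  have := (tendsto_cexp_two_pi.const_mul 27).mul (tendsto_cubicS_unit.pow 6)
  simp_rw [← pow_mul] at this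
  simpa using this

/-- A holomorphic function on the upper half-plane of period 1 with a limit at `i∞` is an analytic
function of `q = exp (2πiτ)`. -/
lemma exists_analyticAt_of_periodic {f : ℂ → ℂ} {c : ℂ}
    (hd : ∀ τ : ℂ, 0 < τ.im → DifferentiableAt ℂ f τ)
    (hT : ∀ τ : ℂ, 0 < τ.im → f (τ + 1) = f τ) (hlim : Tendsto f (comap im atTop) (𝓝 c)) :
    ∃ F : ℂ → ℂ, AnalyticAt ℂ F 0 ∧ F 0 = c ∧
      ∀ τ : ℂ, 0 < τ.im → f τ = F (cexp (2 * Real.pi * I * τ)) := by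
  classical
  have : (comap im atTop).NeBot := atTop_neBot.comap_of_surj im_surjective
  set g : ℂ → ℂ := fun τ => if 0 < τ.im then f τ else c
  have hev : ∀ᶠ τ : ℂ in comap im atTop, 0 < τ.im := preimage_mem_comap (Ioi_mem_atTop (0 : ℝ))
  have hper : Function.Periodic g (1 : ℝ) := fun τ => by
    by_cases h : 0 < τ.im <;> simp [g, h, hT]
  have hgd : ∀ᶠ τ in comap im atTop, DifferentiableAt ℂ g τ := by
    filter_upwards [hev] with τ hτ
    refine (hd τ hτ).congr_of_eventuallyEq ?_
    filter_upwards [(isOpen_lt continuous_const continuous_im).mem_nhds hτ] with z hz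
    exact if_pos hz
  have hglim : Tendsto g (comap im atTop) (𝓝 c) := by
    refine hlim.congr' ?_
    filter_upwards [hev] with τ hτ
    exact (if_pos hτ).symm
  have hbd : BoundedAtFilter (comap im atTop) g := hglim.isBigO_one ℝ
  have h0 := Function.Periodic.differentiableAt_cuspFunction_zero one_pos hper hgd hbd
  refine ⟨Function.Periodic.cuspFunction 1 g, ?_, ?_, fun τ hτ => ?_⟩
  · rw [analyticAt_iff_eventually_differentiableAt]
    have h1 := Function.Periodic.eventually_differentiableAt_cuspFunction_nhds_ne_zero one_pos
      hper hgd
    rw [eventually_nhdsWithin_iff] at h1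
    filter_upwards [h1] with q hq
    by_cases h : q = 0
    · rwa [h]
    · exact hq h
  · exact tendsto_nhds_unique (Function.Periodic.tendsto_at_I_inf one_pos hper hgd hbd) hglim
  · have := Function.Periodic.eq_cuspFunction one_ne_zero hper τ
    simp only [Function.Periodic.qParam, ofReal_one, div_one] at this
    rw [this]
    exact (if_pos hτ).symm

/-- The cubic theta function identity `a³ = b³ + c³`. -/
lemma cubicE_pow_three {τ : ℂ} (hτ : 0 < τ.im) : cubicE τ ^ 3 = 1 + cubicS τ ^ 6 := by
  set f : ℂ → ℂ := fun τ => cubicE τ ^ 3 - 1 - cubicS τ ^ 6 with hf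
  have hfd : ∀ τ : ℂ, 0 < τ.im → DifferentiableAt ℂ f τ := fun τ hτ =>
    (((differentiableAt_cubicE hτ).pow 3).sub_const 1).sub ((differentiableAt_cubicS hτ).pow 6)
  have hT : ∀ τ : ℂ, 0 < τ.im → f (τ + 1) = f τ := fun τ hτ => by
    simp only [hf, cubicE_add_one hτ, cubicS_add_one, mul_pow, cexp_pi_mul_I_div_three_pow_six,
      one_mul]
  have hz := eq_zero_of_fricke_invariant (N := 3) (by norm_num) le_rfl
    (g := fun τ => (f τ / cubicS τ ^ 3) ^ 2) ?_ ?_ ?_ ?_ τ hτ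
  · have h1 := cubicS_ne_zero hτ
    have : f τ = 0 := by simpa [h1] using hz
    linear_combination this
  · exact fun τ hτ => ((DifferentiableAt.div (hfd τ hτ) ((differentiableAt_cubicS hτ).pow 3)
      (pow_ne_zero 3 (cubicS_ne_zero hτ))).pow 2).differentiableWithinAt
  · intro τ hτ
    simp only [hT τ hτ, cubicS_add_one, mul_pow, div_pow, cexp_pi_mul_I_div_three_pow_three]
    norm_num
  · intro τ hτ
    have h1 := cubicS_ne_zero hτ
    simp only [hf]
    push_cast
    rw [cubicE_fricke hτ, cubicS_fricke hτ]
    field_simp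
    ring
  · have hlim : Tendsto f (comap im atTop) (𝓝 0) := by
      simpa using ((tendsto_cubicE.pow 3).sub_const 1).sub tendsto_cubicS_pow_six
    obtain ⟨F, hFa, hF0, hF⟩ := exists_analyticAt_of_periodic hfd hT hlim
    have hO : F =O[𝓝 0] (fun q => q) := by
      simpa [hF0] using hFa.differentiableAt.isBigO_sub
    have ho : (fun q => F q ^ 2) =o[𝓝 0] (fun q : ℂ => q) :=
      (hO.pow 2).trans_isLittleO (by
        simpa using Asymptotics.isLittleO_pow_pow (𝕜 := ℂ) (m := 1) (n := 2) (by norm_num))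
    have h1 := (ho.tendsto_div_nhds_zero.comp tendsto_cexp_two_pi).div
      ((tendsto_cubicS_unit.pow 6).const_mul 27) (by norm_num)
    rw [zero_div] at h1
    refine h1.congr' ?_
    filter_upwards [preimage_mem_comap (Ioi_mem_atTop (0 : ℝ))] with z hz
    simp only [Function.comp_apply, Pi.div_apply]
    rw [hF z hz, div_pow (F _), ← pow_mul, ← pow_mul, cubicS_pow_six_eq, div_div]
    congr 1
    ring

lemma im_neg_inv_mul_pos {N : ℝ} (hN : 0 < N) {τ : ℂ} (hτ : 0 < τ.im) :
    0 < (-1 / (N * τ)).im := by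
  have h : 0 < normSq τ := normSq_pos.mpr fun h => by simp [h] at hτ
  rw [show -1 / (N * τ) = (((-N⁻¹ : ℝ)) : ℂ) * τ⁻¹ by
    push_cast; rw [neg_mul, ← mul_inv]; ring, im_ofReal_mul, inv_im]
  have : 0 < N⁻¹ * (τ.im / normSq τ) := by positivity
  linarith [show -N⁻¹ * (-τ.im / normSq τ) = N⁻¹ * (τ.im / normSq τ) by ring]

lemma im_fricke_pos {τ : ℂ} (hτ : 0 < τ.im) : 0 < (-1 / (3 * τ)).im := by
  simpa using im_neg_inv_mul_pos (N := 3) (by norm_num) hτ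

lemma cubic_lower {z : ℂ} (hz : 0 < z.im) :
    cubicS (z / (3 * z + 1)) = cexp (Real.pi * I / 3) * cubicS z ∧
      cubicE (z / (3 * z + 1)) = cexp (Real.pi * I / 3) ^ 2 * cubicE z := by
  set x := -1 / (3 * z) - 1 with hx
  have hz0 : z ≠ 0 := fun h => by simp [h] at hz
  have hw := im_fricke_pos hz
  have hxim : 0 < x.im := by simpa [hx] using hw
  have hx0 : x ≠ 0 := fun h => by simp [h] at hxim
  have h1 : z / (3 * z + 1) = -1 / (3 * x) := by
    have : x = -(3 * z + 1) / (3 * z) := by rw [hx]; field_simp; ring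
    rw [this]
    field_simp
  have h2 : cubicS (-1 / (3 * z)) = cexp (Real.pi * I / 3) * cubicS x := by
    rw [← cubicS_add_one, hx, sub_add_cancel]
  have h3 : cubicE (-1 / (3 * z)) = cubicE x := by
    rw [← cubicE_add_one hxim, hx, sub_add_cancel]
  rw [cubicS_fricke hz] at h2
  rw [cubicE_fricke hz] at h3
  have hS := cubicS_ne_zero hz
  have hSx := cubicS_ne_zero hxim
  have he := Complex.exp_ne_zero (Real.pi * I / 3)
  rw [h1, cubicS_fricke hxim, cubicE_fricke hxim, ← h3]
  have h4 : cubicS x = (cexp (Real.pi * I / 3) * cubicS z)⁻¹ := by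
    rw [mul_inv, h2]
    field_simp
  rw [h4]
  constructor
  · simp
  · field_simp

lemma cexp_pi_div_three_zpow_eq {m n : ℤ} (h : m % 6 = n % 6) :
    cexp (Real.pi * I / 3) ^ m = cexp (Real.pi * I / 3) ^ n := by
  rw [← Int.ediv_mul_add_emod m 6, ← Int.ediv_mul_add_emod n 6, h,
    zpow_add₀ (Complex.exp_ne_zero _), zpow_add₀ (Complex.exp_ne_zero _), mul_comm (m / 6),
    mul_comm (n / 6), zpow_mul, zpow_mul]
  have : cexp (Real.pi * I / 3) ^ (6 : ℤ) = 1 := by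
    exact_mod_cast cexp_pi_mul_I_div_three_pow_six
  rw [this, one_zpow, one_zpow]

lemma denom_ne_zero_of_det {a b c d : ℤ} (h : a * d - 3 * b * c = 1) {τ : ℂ} (hτ : 0 < τ.im) :
    3 * (c : ℂ) * τ + d ≠ 0 := by
  intro h0
  have him := congrArg Complex.im h0
  have hre := congrArg Complex.re h0
  have h3 : (3 * (c : ℂ)) = ((3 * c : ℝ) : ℂ) := by push_cast; ring
  rw [h3, add_im, im_ofReal_mul] at him
  rw [h3, add_re, re_ofReal_mul] at hre
  simp only [intCast_im, add_zero, zero_im, mul_eq_zero, hτ.ne', or_false] at him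
  have hc : c = 0 := by simpa using him
  subst hc
  have hd : d = 0 := by simpa using hre
  subst hd
  simp at h

lemma im_moebius_pos {a b c d : ℤ} (h : a * d - 3 * b * c = 1) {τ : ℂ} (hτ : 0 < τ.im) :
    0 < (((a : ℂ) * τ + b) / (3 * c * τ + d)).im := by
  have h0 := denom_ne_zero_of_det h hτ
  have hn := normSq_pos.mpr h0
  have hR : ((a * d - 3 * b * c : ℤ) : ℝ) = 1 := by exact_mod_cast h
  push_cast at hR
  rw [Complex.div_im, ← sub_div]
  refine div_pos ?_ hn
  have h3 : (3 * (c : ℂ)) = ((3 * c : ℝ) : ℂ) := by push_cast; ring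
  have ha : (a : ℂ) = ((a : ℝ) : ℂ) := by simp
  rw [h3, ha, add_im, add_re, add_re, add_im, im_ofReal_mul, re_ofReal_mul, im_ofReal_mul,
    re_ofReal_mul]
  simp only [intCast_im, intCast_re, add_zero]
  have : (a * τ.im : ℝ) * (3 * c * τ.re + d) - (a * τ.re + b) * (3 * c * τ.im) = τ.im := by
    linear_combination τ.im * hR
  rw [this]
  exact hτ

/-- The transformation behaviour of `cubicS` and `cubicE` under the matrix `(a, b; 3c, d)`. -/
def CubicTransform (a b c d : ℤ) : Prop := ∀ τ : ℂ, 0 < τ.im →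
  cubicS ((a * τ + b) / (3 * c * τ + d)) =
      cexp (Real.pi * I / 3) ^ (3 * (a * b + b * c + c * d) - 2 * (b * d + a * c)) * cubicS τ ∧
    cubicE ((a * τ + b) / (3 * c * τ + d)) = cexp (Real.pi * I / 3) ^ (2 * (a * c)) * cubicE τ

lemma exists_sq_eq_of_mul_sub {a d m : ℤ} (h : a * d - 3 * m = 1) : ∃ k, d ^ 2 = 3 * k + 1 := by
  obtain ⟨e, he | he | he⟩ : ∃ e, d = 3 * e ∨ d = 3 * e + 1 ∨ d = 3 * e + 2 := ⟨d / 3, by lia⟩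
  · have : (3 : ℤ) ∣ 1 := ⟨a * e - m, by rw [he] at h; linear_combination -h⟩
    norm_num at this
  · exact ⟨3 * e ^ 2 + 2 * e, by rw [he]; ring⟩
  · exact ⟨3 * e ^ 2 + 4 * e + 1, by rw [he]; ring⟩

lemma cubicTransform_upper {a b c d : ℤ} (h : a * d - 3 * b * c = 1) :
    CubicTransform (a + 3 * c) (b + d) c d ↔ CubicTransform a b c d := by
  refine forall_congr' fun τ => forall_congr' fun hτ => ?_
  have h0 := denom_ne_zero_of_det h hτ
  have hz := im_moebius_pos h hτ
  have he := Complex.exp_ne_zero (Real.pi * I / 3)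
  have h1 : (((a + 3 * c : ℤ) : ℂ) * τ + (b + d : ℤ)) / (3 * c * τ + d) =
      (a * τ + b) / (3 * c * τ + d) + 1 := by
    rw [div_add_one h0]
    push_cast
    ring
  have e1 : ((3 * ((a + 3 * c) * (b + d) + (b + d) * c + c * d) -
      2 * ((b + d) * d + (a + 3 * c) * c))) % 6 =
      (1 + (3 * (a * b + b * c + c * d) - 2 * (b * d + a * c))) % 6 := by
    obtain ⟨k, hk⟩ := exists_sq_eq_of_mul_sub (a := a) (d := d) (m := b * c)
      (by linear_combination h)
    refine (Int.modEq_iff_dvd.mpr ⟨3 * b * c + 2 * c * d - k - c ^ 2, ?_⟩).symm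
    linear_combination 3 * h - 2 * hk
  have e2 : (2 * ((a + 3 * c) * c)) % 6 = (2 * (a * c)) % 6 := by
    rw [show 2 * ((a + 3 * c) * c) = 2 * (a * c) + 6 * (c * c) by ring, Int.add_mul_emod_self_left]
  rw [h1, cubicS_add_one, cubicE_add_one hz, cexp_pi_div_three_zpow_eq e1,
    cexp_pi_div_three_zpow_eq e2, zpow_one_add₀ he, mul_assoc (cexp _), mul_right_inj' he]

lemma cubicTransform_lower {a b c d : ℤ} (h : a * d - 3 * b * c = 1) :
    CubicTransform a b (c + a) (d + 3 * b) ↔ CubicTransform a b c d := by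
  refine forall_congr' fun τ => forall_congr' fun hτ => ?_
  have h0 := denom_ne_zero_of_det h hτ
  have hz := im_moebius_pos h hτ
  have he := Complex.exp_ne_zero (Real.pi * I / 3)
  have hS := cubic_lower hz
  have h1 : ((a : ℂ) * τ + b) / (3 * (c + a : ℤ) * τ + (d + 3 * b : ℤ)) =
      (a * τ + b) / (3 * c * τ + d) / (3 * ((a * τ + b) / (3 * c * τ + d)) + 1) := by
    rw [← mul_div_assoc, div_add_one h0, div_div_div_cancel_right₀ h0]
    push_cast
    ring
  have e1 : (3 * (a * b + b * (c + a) + (c + a) * (d + 3 * b)) -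
      2 * (b * (d + 3 * b) + a * (c + a))) % 6 =
      (1 + (3 * (a * b + b * c + c * d) - 2 * (b * d + a * c))) % 6 := by
    obtain ⟨k, hk⟩ := exists_sq_eq_of_mul_sub (a := d) (d := a) (m := b * c)
      (by linear_combination h)
    refine (Int.modEq_iff_dvd.mpr ⟨2 * a * b + 3 * b * c - k - b ^ 2, ?_⟩).symm
    linear_combination 3 * h - 2 * hk
  have e2 : (2 * (a * (c + a))) % 6 = (2 + 2 * (a * c)) % 6 := by
    obtain ⟨k, hk⟩ := exists_sq_eq_of_mul_sub (a := d) (d := a) (m := b * c)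
      (by linear_combination h)
    refine (Int.modEq_iff_dvd.mpr ⟨k, ?_⟩).symm
    linear_combination 2 * hk
  rw [h1, hS.1, hS.2, cexp_pi_div_three_zpow_eq e1,
    cexp_pi_div_three_zpow_eq e2, zpow_one_add₀ he, zpow_add₀ he, mul_assoc (cexp _),
    mul_right_inj' he, mul_assoc (_ ^ (2 : ℤ))]
  exact and_congr_right' (mul_right_inj' (pow_ne_zero 2 he))

lemma cubicS_add_int {τ : ℂ} (n : ℤ) :
    cubicS (τ + n) = cexp (Real.pi * I / 3) ^ n * cubicS τ := by
  induction n with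
  | zero => simp
  | succ n ih =>
    rw [zpow_add_one₀ (Complex.exp_ne_zero _), mul_comm (_ ^ _), mul_assoc, ← ih, ← cubicS_add_one]
    push_cast
    rw [add_assoc]
  | pred n ih =>
    rw [← mul_right_inj' (Complex.exp_ne_zero (Real.pi * I / 3)), ← mul_assoc, ← cubicS_add_one,
      ← zpow_one_add₀ (Complex.exp_ne_zero _)]
    convert ih using 2
    · push_cast; ring
    · ring_nf

lemma cubicE_add_int {τ : ℂ} (hτ : 0 < τ.im) (n : ℤ) : cubicE (τ + n) = cubicE τ := by
  induction n with
  | zero => simp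
  | succ n ih =>
    rw [← ih, ← cubicE_add_one (τ := τ + (n : ℤ)) (by simpa using hτ)]
    push_cast
    rw [add_assoc]
  | pred n ih => rw [← ih, ← cubicE_add_one (by simpa using hτ)]; push_cast; ring_nf

lemma cubicTransform_of_det (n : ℕ) : ∀ a b c d : ℤ, a * d - 3 * b * c = 1 →
    a.natAbs + c.natAbs = n → CubicTransform a b c d := by
  induction n using Nat.strong_induction_on with
  | _ n ih =>
  intro a b c d h hn
  by_cases hc : c = 0
  · subst hc
    have had : a * d = 1 := by linear_combination h
    intro τ hτ
    rcases Int.mul_eq_one_iff_eq_one_or_neg_one.mp had with ⟨rfl, rfl⟩ | ⟨rfl, rfl⟩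
    · simp only [Int.cast_one, Int.cast_zero, mul_zero, zero_mul, one_mul, zero_add, div_one,
        add_zero, mul_one, zpow_zero]
      refine ⟨?_, cubicE_add_int hτ b⟩
      rw [cubicS_add_int]
      ring_nf
    · have e : ((-1 : ℤ) * τ + b) / (3 * (0 : ℤ) * τ + (-1 : ℤ)) = τ + ((-b : ℤ) : ℂ) := by
        push_cast
        field_simp
        ring
      rw [e, cubicS_add_int, cubicE_add_int hτ]
      simp only [mul_zero, zpow_zero, one_mul, zero_mul, and_true]
      ring_nf
  have ha : a ≠ 0 := by
    rintro rfl
    lia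
  have hT : a.natAbs * 2 ≤ c.natAbs * 3 ∨ (a + 3 * c).natAbs < a.natAbs ∨
    (a - 3 * c).natAbs < a.natAbs := by lia
  rcases hT with hT | hT | hT
  · have hV : (c + a).natAbs < c.natAbs ∨ (c - a).natAbs < c.natAbs := by lia
    rcases hV with hV | hV
    · rw [← cubicTransform_lower h]
      exact ih _ (by lia) _ _ _ _ (by linear_combination h) rfl
    · have h' : a * (d - 3 * b) - 3 * b * (c - a) = 1 := by linear_combination h
      have := (cubicTransform_lower h').mpr (ih _ (by lia) _ _ _ _ h' rfl)
      simpa using this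
  · rw [← cubicTransform_upper h]
    exact ih _ (by lia) _ _ _ _ (by linear_combination h) rfl
  · have h' : (a - 3 * c) * d - 3 * (b - d) * c = 1 := by linear_combination h
    have := (cubicTransform_upper h').mpr (ih _ (by lia) _ _ _ _ h' rfl)
    simpa using this


lemma cubicS_moebius {a b c d : ℤ} (h : a * d - 3 * b * c = 1) (hb : 6 ∣ b) (hc : 6 ∣ c) {τ : ℂ}
    (hτ : 0 < τ.im) : cubicS ((a * τ + b) / (3 * c * τ + d)) = cubicS τ := by
  obtain ⟨b, rfl⟩ := hb
  obtain ⟨c, rfl⟩ := hc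
  rw [(cubicTransform_of_det _ _ _ _ _ h rfl τ hτ).1, cexp_pi_div_three_zpow_eq (n := 0), zpow_zero,
    one_mul]
  exact (Int.modEq_iff_dvd.mpr ⟨-(3 * (a * b + 6 * b * c + c * d) - 2 * (b * d + a * c)), by ring⟩)

lemma cubicE_moebius {a b c d : ℤ} (h : a * d - 3 * b * c = 1) (hc : 6 ∣ c) {τ : ℂ}
    (hτ : 0 < τ.im) : cubicE ((a * τ + b) / (3 * c * τ + d)) = cubicE τ := by
  obtain ⟨c, rfl⟩ := hc
  rw [(cubicTransform_of_det _ _ _ _ _ h rfl τ hτ).2, cexp_pi_div_three_zpow_eq (n := 0), zpow_zero,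
    one_mul]
  exact (Int.modEq_iff_dvd.mpr ⟨-(2 * (a * c)), by ring⟩)

/-- The product of the values of `f` at `τ` and at the points `(τ + x) / p`, for `x` modulo `p`. -/
noncomputable def heckeNorm (p : ℕ) [NeZero p] (f : ℂ → ℂ) (τ : ℂ) : ℂ :=
  f τ * ∏ x : ZMod p, f ((τ + x.val) / p)

section Norm

variable {p : ℕ} {f : ℂ → ℂ}

lemma im_add_natCast_div_pos (hp : 0 < p) {τ : ℂ} (hτ : 0 < τ.im) (x : ℕ) :
    0 < ((τ + x) / p).im := by
  rw [show ((τ + x) / p : ℂ) = (((p : ℝ)⁻¹ : ℝ) : ℂ) * (τ + x) by push_cast; ring, im_ofReal_mul]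
  have : 0 < (p : ℝ) := by exact_mod_cast hp
  simp only [add_im, natCast_im, add_zero]
  positivity

lemma periodic_int (hT : ∀ τ : ℂ, 0 < τ.im → f (τ + 1) = f τ) {τ : ℂ} (hτ : 0 < τ.im) (n : ℤ) :
    f (τ + n) = f τ := by
  induction n with
  | zero => simp
  | succ n ih =>
    rw [← ih, ← hT (τ + (n : ℤ)) (by simpa using hτ)]
    push_cast
    rw [add_assoc]
  | pred n ih => rw [← ih, ← hT _ (by simpa using hτ)]; push_cast; ring_nf

lemma apply_add_val_div [NeZero p] (hT : ∀ τ : ℂ, 0 < τ.im → f (τ + 1) = f τ) {τ : ℂ}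
    (hτ : 0 < τ.im) {x : ZMod p} {m : ℤ} (h : (m : ZMod p) = x) :
    f ((τ + x.val) / p) = f ((τ + m) / p) := by
  have h1 : (((m - x.val : ℤ)) : ZMod p) = 0 := by simp [h]
  obtain ⟨r, hr⟩ := (ZMod.intCast_zmod_eq_zero_iff_dvd _ p).mp h1
  have hp : (p : ℂ) ≠ 0 := by exact_mod_cast NeZero.ne p
  have : (m : ℂ) = x.val + p * r := by exact_mod_cast (by linarith : m = x.val + p * r)
  rw [this, ← periodic_int hT (im_add_natCast_div_pos (NeZero.pos p) hτ _) r]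
  congr 1
  field_simp
  ring

lemma heckeNorm_add_one [NeZero p] (hT : ∀ τ : ℂ, 0 < τ.im → f (τ + 1) = f τ) {τ : ℂ}
    (hτ : 0 < τ.im) : heckeNorm p f (τ + 1) = heckeNorm p f τ := by
  rw [heckeNorm, heckeNorm, hT τ hτ]
  congr 1
  refine Fintype.prod_equiv (Equiv.addRight 1) _ _ fun x => ?_
  rw [apply_add_val_div hT hτ (m := x.val + 1) (by simp)]
  push_cast
  ring_nf

lemma differentiableOn_heckeNorm [NeZero p] (hf : DifferentiableOn ℂ f {τ | 0 < τ.im}) :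
    DifferentiableOn ℂ (heckeNorm p f) {τ | 0 < τ.im} := by
  refine hf.mul (DifferentiableOn.fun_finsetProd fun x _ => ?_)
  refine hf.comp (by fun_prop) fun τ hτ => ?_
  exact im_add_natCast_div_pos (NeZero.pos p) hτ _

lemma tendsto_heckeNorm [NeZero p] (hf : Tendsto f (comap im atTop) (𝓝 0)) :
    Tendsto (heckeNorm p f) (comap im atTop) (𝓝 0) := by
  rw [show (0 : ℂ) = 0 * ∏ x : ZMod p, 0 by simp]
  refine hf.mul (tendsto_finsetProd _ fun x _ => hf.comp ?_)
  refine tendsto_comap_iff.mpr ?_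
  have hp : 0 < (p : ℝ) := by exact_mod_cast NeZero.pos p
  refine (tendsto_comap.atTop_div_const hp).congr fun τ => ?_
  rw [Function.comp_apply, show ((τ + x.val) / p : ℂ) = (((p : ℝ)⁻¹ : ℝ) : ℂ) * (τ + x.val) by
    push_cast; ring, im_ofReal_mul, add_im, natCast_im, add_zero, div_eq_inv_mul]

lemma isPreconnected_im_pos : IsPreconnected {τ : ℂ | 0 < τ.im} :=
  (convex_halfSpace_im_gt 0).isPreconnected

lemma eq_zero_of_heckeNorm_eq_zero [NeZero p] (hf : DifferentiableOn ℂ f {τ | 0 < τ.im})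
    (h : ∀ τ : ℂ, 0 < τ.im → heckeNorm p f τ = 0) {τ : ℂ} (hτ : 0 < τ.im) : f τ = 0 := by
  have hp : (p : ℂ) ≠ 0 := by exact_mod_cast NeZero.ne p
  have ho : IsOpen {τ : ℂ | 0 < τ.im} := isOpen_lt continuous_const continuous_im
  have hg : ∀ x : ZMod p, DifferentiableOn ℂ (fun τ => f ((τ + x.val) / p)) {τ | 0 < τ.im} :=
    fun x => hf.comp (by fun_prop) fun τ hτ => im_add_natCast_div_pos (NeZero.pos p) hτ _
  have key : ∀ s : Finset (ZMod p),
      (∀ τ ∈ {τ : ℂ | 0 < τ.im}, f τ * ∏ x ∈ s, f ((τ + x.val) / p) = 0) →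
      ∀ τ ∈ {τ : ℂ | 0 < τ.im}, f τ = 0 := by
    intro s
    induction s using Finset.cons_induction with
    | empty => simp
    | cons a s ha ih =>
      intro H
      have hA : DifferentiableOn ℂ (fun τ => f τ * ∏ x ∈ s, f ((τ + x.val) / p)) {τ | 0 < τ.im} :=
        hf.mul (DifferentiableOn.fun_finsetProd fun x _ => hg x)
      rcases AnalyticOnNhd.eq_zero_or_eq_zero_of_mul_eq_zero (hA.analyticOnNhd ho)
        ((hg a).analyticOnNhd ho) (fun τ hτ => by
          rw [← H τ hτ, Finset.prod_cons]; ring) isPreconnected_im_pos with h1 | h1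
      · exact ih h1
      · intro τ hτ
        have hpτ : 0 < (p * τ).im := by
          have : 0 < (p : ℝ) := by exact_mod_cast NeZero.pos p
          rw [← ofReal_natCast, im_ofReal_mul]
          exact mul_pos this hτ
        have := h1 (p * τ - (a.val : ℕ)) (by
          rwa [Set.mem_ofPred_eq, sub_im, natCast_im, sub_zero])
        rwa [sub_add_cancel, mul_div_cancel_left₀ _ hp] at this
  exact key Finset.univ h τ hτ

variable {fh : ℂ → ℂ}

lemma heckeNorm_fricke [Fact p.Prime] (hp3 : 3 < p) (hT : ∀ τ : ℂ, 0 < τ.im → f (τ + 1) = f τ)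
    (hTh : ∀ τ : ℂ, 0 < τ.im → fh (τ + 1) = fh τ)
    (hW : ∀ τ : ℂ, 0 < τ.im → f (-1 / (3 * τ)) = fh (τ / p))
    (hγ : ∀ k k' : ℤ, (p : ℤ) ∣ 1 + 1728 * k * k' → ∀ τ : ℂ, 0 < τ.im →
      fh (τ / (1 - 72 * k * τ)) = fh ((τ + 24 * k') / p))
    {τ : ℂ} (hτ : 0 < τ.im) : heckeNorm p f (-1 / (3 * τ)) = heckeNorm p fh τ := by
  have hp := Fact.out (p := p.Prime)
  have hpc : (p : ℂ) ≠ 0 := by exact_mod_cast hp.ne_zero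
  have hτ0 : τ ≠ 0 := fun h => by simp [h] at hτ
  have hpτ : 0 < (p * τ).im := by
    rw [← ofReal_natCast, im_ofReal_mul]
    exact mul_pos (by exact_mod_cast hp.pos) hτ
  have h3 : ((3 : ℕ) : ZMod p) ≠ 0 := by
    rw [Ne, ZMod.natCast_eq_zero_iff]
    exact fun h => absurd (Nat.le_of_dvd (by norm_num) h) (by lia)
  have h24 : ((24 : ℕ) : ZMod p) ≠ 0 := by
    rw [Ne, ZMod.natCast_eq_zero_iff, show 24 = 2 ^ 3 * 3 by norm_num]
    intro h
    rcases hp.dvd_mul.mp h with h | h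
    · exact absurd (Nat.le_of_dvd (by norm_num) (hp.dvd_of_dvd_pow h)) (by lia)
    · exact absurd (Nat.le_of_dvd (by norm_num) h) (by lia)
  push_cast at h3 h24
  have hinv : Function.Involutive fun x : ZMod p => -(3 * x)⁻¹ := by
    intro x
    simp only [mul_neg, inv_neg, neg_neg, mul_inv, inv_inv]
    field_simp
  have hx : ∀ x : ZMod p, x ≠ 0 →
      f ((-1 / (3 * τ) + x.val) / p) = fh ((τ + (-(3 * x)⁻¹).val) / p) := by
    intro x hx
    obtain ⟨k, hkc⟩ := ZMod.intCast_surjective (x * 24⁻¹)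
    obtain ⟨k', hkc'⟩ := ZMod.intCast_surjective (-(3 * x)⁻¹ * 24⁻¹)
    have hdvd : (p : ℤ) ∣ 1 + 1728 * k * k' := by
      rw [← ZMod.intCast_zmod_eq_zero_iff_dvd]
      push_cast
      rw [hkc, hkc']
      field_simp
      norm_num
    have hden : 1 - 72 * (k : ℂ) * τ ≠ 0 := by
      have := denom_ne_zero_of_det (a := 1) (b := 0) (c := -24 * k) (d := 1) (by ring) hτ
      convert this using 1
      push_cast
      ring
    have him : 0 < (τ / (1 - 72 * k * τ)).im := by
      have := im_moebius_pos (a := 1) (b := 0) (c := -24 * k) (d := 1) (by ring) hτ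
      convert this using 2
      push_cast
      ring
    rw [apply_add_val_div hT (im_fricke_pos hτ) (m := 24 * k) (by push_cast; rw [hkc]; field_simp),
      apply_add_val_div hTh hτ (m := 24 * k') (by push_cast; rw [hkc']; field_simp)]
    push_cast
    rw [← hγ k k' hdvd τ hτ]
    have e1 : τ / (1 - 72 * k * τ) = (p * (τ / (1 - 72 * k * τ))) / p := by field_simp
    rw [e1, ← hW _ (by
      rw [← ofReal_natCast, im_ofReal_mul]
      exact mul_pos (by exact_mod_cast hp.pos) him)]
    congr 1
    field_simp
    ring
  have h0 : f (-1 / (3 * τ) / p) = fh τ := by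
    have := hW (p * τ) hpτ
    rw [mul_div_cancel_left₀ _ hpc] at this
    rw [← this]
    congr 1
    field_simp
  rw [heckeNorm, heckeNorm, hW τ hτ]
  rw [← Finset.mul_prod_erase _ _ (Finset.mem_univ (0 : ZMod p)),
    ← Finset.mul_prod_erase _ (fun x : ZMod p => fh ((τ + x.val) / p))
      (Finset.mem_univ (0 : ZMod p))]
  simp only [ZMod.val_zero, Nat.cast_zero, add_zero]
  rw [h0, mul_left_comm]
  congr 2
  refine Finset.prod_equiv (hinv.toPerm) ?_ ?_
  · intro x
    simp [h3]
  · intro x hx'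
    exact hx x (by simpa using hx')

lemma eq_zero_of_heckeNorm [Fact p.Prime] (hp3 : 3 < p)
    (hf : DifferentiableOn ℂ f {τ | 0 < τ.im}) (hfh : DifferentiableOn ℂ fh {τ | 0 < τ.im})
    (hT : ∀ τ : ℂ, 0 < τ.im → f (τ + 1) = f τ)
    (hTh : ∀ τ : ℂ, 0 < τ.im → fh (τ + 1) = fh τ)
    (hW : ∀ τ : ℂ, 0 < τ.im → f (-1 / (3 * τ)) = fh (τ / p))
    (hγ : ∀ k k' : ℤ, (p : ℤ) ∣ 1 + 1728 * k * k' → ∀ τ : ℂ, 0 < τ.im →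
      fh (τ / (1 - 72 * k * τ)) = fh ((τ + 24 * k') / p))
    (hlim : Tendsto (fun τ => f τ * fh τ) (comap im atTop) (𝓝 0)) {τ : ℂ} (hτ : 0 < τ.im) :
    f τ = 0 := by
  have ho : IsOpen {τ : ℂ | 0 < τ.im} := isOpen_lt continuous_const continuous_im
  have hN : ∀ τ : ℂ, 0 < τ.im → heckeNorm p f (-1 / (3 * τ)) = heckeNorm p fh τ :=
    fun τ hτ => heckeNorm_fricke hp3 hT hTh hW hγ hτ
  have hWW : ∀ τ : ℂ, -1 / (3 * (-1 / (3 * τ))) = τ := fun τ => by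
    by_cases h : τ = 0
    · simp [h]
    · field_simp
  have hprod : ∀ τ ∈ {τ : ℂ | 0 < τ.im}, heckeNorm p f τ * heckeNorm p fh τ = 0 := by
    refine eq_zero_of_fricke_invariant (N := 3) (by norm_num) le_rfl
      ((differentiableOn_heckeNorm hf).mul (differentiableOn_heckeNorm hfh)) (fun τ hτ => ?_)
      (fun τ hτ => ?_) ?_
    · rw [heckeNorm_add_one hT hτ, heckeNorm_add_one hTh hτ]
    · push_cast
      have := hN _ (im_fricke_pos hτ)
      rw [hWW] at this
      rw [hN τ hτ, ← this, mul_comm]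
    · refine (tendsto_heckeNorm (p := p) hlim).congr fun τ => ?_
      simp only [heckeNorm, Finset.prod_mul_distrib]
      ring
  rcases AnalyticOnNhd.eq_zero_or_eq_zero_of_mul_eq_zero
    ((differentiableOn_heckeNorm hf).analyticOnNhd ho)
    ((differentiableOn_heckeNorm hfh).analyticOnNhd ho) hprod isPreconnected_im_pos with h | h
  · exact eq_zero_of_heckeNorm_eq_zero hf h hτ
  · refine eq_zero_of_heckeNorm_eq_zero (p := p) hf (fun τ hτ => ?_) hτ
    rw [← hWW τ, hN _ (im_fricke_pos hτ)]
    exact h _ (im_fricke_pos hτ)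

end Norm

section Taylor

/-- Taylor expansion with an analytic remainder. -/
lemma AnalyticAt.exists_taylor_zero {f : ℂ → ℂ} (hf : AnalyticAt ℂ f 0) (m : ℕ) :
    ∃ (a : ℕ → ℂ) (H : ℂ → ℂ), AnalyticAt ℂ H 0 ∧
      ∀ q, f q = ∑ j ∈ Finset.range m, a j * q ^ j + q ^ m * H q := by
  induction m with
  | zero => exact ⟨0, f, hf, by simp⟩
  | succ m ih =>
    obtain ⟨a, H, hH, h⟩ := ih
    obtain ⟨P, hP⟩ := hH
    refine ⟨Function.update a m (H 0), dslope H 0, ⟨_, hP.has_fpower_series_dslope_fslope⟩,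
      fun q => ?_⟩
    have h1 : H q = H 0 + q * dslope H 0 q := by
      have := sub_smul_dslope H 0 q
      simp only [sub_zero, smul_eq_mul] at this
      rw [this]
      ring
    rw [h, Finset.sum_range_succ, Function.update_self, h1]
    have : ∑ j ∈ Finset.range m, Function.update a m (H 0) j * q ^ j =
        ∑ j ∈ Finset.range m, a j * q ^ j :=
      Finset.sum_congr rfl fun j hj => by
        rw [Function.update_of_ne (Finset.mem_range.mp hj).ne]
    rw [this]
    ring

/-- More than `m` analytic functions have a nontrivial linear combination vanishing to order
`m`. -/
lemma exists_sum_eq_pow_mul {ι : Type*} [Fintype ι] {m : ℕ} (hm : m < Fintype.card ι)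
    {F : ι → ℂ → ℂ} (hF : ∀ k, AnalyticAt ℂ (F k) 0) :
    ∃ c : ι → ℂ, c ≠ 0 ∧ ∃ H : ℂ → ℂ, AnalyticAt ℂ H 0 ∧ ∀ q, ∑ k, c k * F k q = q ^ m * H q := by
  choose a H hH h using fun k => (hF k).exists_taylor_zero m
  let T : (ι → ℂ) →ₗ[ℂ] (Fin m → ℂ) :=
    LinearMap.pi fun j => ∑ k, (a k j) • LinearMap.proj (R := ℂ) (φ := fun _ : ι => ℂ) k
  have hker : LinearMap.ker T ≠ ⊥ := LinearMap.ker_ne_bot_of_finrank_lt (by simpa using hm)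
  obtain ⟨c, hc, hc0⟩ := Submodule.exists_mem_ne_zero_of_ne_bot hker
  refine ⟨c, hc0, fun q => ∑ k, c k * H k q, ?_, fun q => ?_⟩
  · exact Finset.univ.analyticAt_fun_sum fun k _ => analyticAt_const.mul (hH k)
  · have hT : ∀ j < m, ∑ k, c k * a k j = 0 := fun j hj => by
      have := congrFun (LinearMap.mem_ker.mp hc) ⟨j, hj⟩
      simpa [T, mul_comm] using this
    have h1 : ∑ k, c k * ∑ j ∈ Finset.range m, a k j * q ^ j = 0 := by
      simp_rw [Finset.mul_sum]
      rw [Finset.sum_comm]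
      refine Finset.sum_eq_zero fun j hj => ?_
      simp_rw [← mul_assoc]
      rw [← Finset.sum_mul, hT j (Finset.mem_range.mp hj), zero_mul]
    simp_rw [h, mul_add, Finset.sum_add_distrib]
    rw [h1, zero_add, Finset.mul_sum]
    exact Finset.sum_congr rfl fun k _ => by ring

end Taylor

noncomputable def pairS (p δ : ℕ) (τ : ℂ) : ℂ := (cubicS τ * cubicS (p * τ)) ^ δ

noncomputable def pairE (p δ : ℕ) (τ : ℂ) : ℂ := (cubicE τ * cubicE (p * τ)) ^ δ

section Pair

variable {p δ : ℕ}

lemma im_natCast_mul_pos (hp : 0 < p) {τ : ℂ} (hτ : 0 < τ.im) : 0 < (p * τ).im := by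
  rw [← ofReal_natCast, im_ofReal_mul]
  exact mul_pos (by exact_mod_cast hp) hτ

lemma pairS_ne_zero (hp : 0 < p) {τ : ℂ} (hτ : 0 < τ.im) : pairS p δ τ ≠ 0 :=
  pow_ne_zero _ (mul_ne_zero (cubicS_ne_zero hτ) (cubicS_ne_zero (im_natCast_mul_pos hp hτ)))

lemma pairS_add_one (h6 : 6 ∣ (p + 1) * δ) (τ : ℂ) : pairS p δ (τ + 1) = pairS p δ τ := by
  obtain ⟨N, hN⟩ := h6
  have := cubicS_add_int (τ := p * τ) p
  push_cast at this
  rw [pairS, pairS, mul_add, mul_one, cubicS_add_one, this, zpow_natCast]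
  have h1 : (cexp (Real.pi * I / 3) ^ (p + 1)) ^ δ = 1 := by
    rw [← pow_mul, hN, pow_mul, cexp_pi_mul_I_div_three_pow_six, one_pow]
  rw [← one_mul ((cubicS τ * _) ^ δ), ← h1]
  ring

lemma pairE_add_one (hp : 0 < p) {τ : ℂ} (hτ : 0 < τ.im) : pairE p δ (τ + 1) = pairE p δ τ := by
  have := cubicE_add_int (im_natCast_mul_pos hp hτ) p
  push_cast at this
  rw [pairE, pairE, mul_add, mul_one, cubicE_add_one hτ, this]

lemma im_div_natCast_pos (hp : 0 < p) {τ : ℂ} (hτ : 0 < τ.im) : 0 < (τ / p).im := by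
  simpa using im_add_natCast_div_pos hp hτ 0

lemma natCast_mul_fricke (hp : 0 < p) (τ : ℂ) : p * (-1 / (3 * τ)) = -1 / (3 * (τ / p)) := by
  have : (p : ℂ) ≠ 0 := by exact_mod_cast hp.ne'
  by_cases h : τ = 0
  · simp [h]
  · field_simp

lemma pairS_fricke (hp : 0 < p) {τ : ℂ} (hτ : 0 < τ.im) :
    pairS p δ (-1 / (3 * τ)) = (pairS p δ (τ / p))⁻¹ := by
  have : (p : ℂ) ≠ 0 := by exact_mod_cast hp.ne'
  rw [pairS, pairS, natCast_mul_fricke hp, cubicS_fricke hτ,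
    cubicS_fricke (im_div_natCast_pos hp hτ),
    mul_div_cancel₀ _ this, ← mul_inv, inv_pow, mul_comm (cubicS τ)]

lemma pairE_fricke (hp : 0 < p) {τ : ℂ} (hτ : 0 < τ.im) :
    pairE p δ (-1 / (3 * τ)) = pairE p δ (τ / p) / pairS p δ (τ / p) ^ 2 := by
  have : (p : ℂ) ≠ 0 := by exact_mod_cast hp.ne'
  rw [pairE, pairE, pairS, natCast_mul_fricke hp, cubicE_fricke hτ,
    cubicE_fricke (im_div_natCast_pos hp hτ), mul_div_cancel₀ _ this, ← pow_mul, mul_comm δ 2,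
    pow_mul, ← div_pow]
  congr 1
  rw [mul_comm, mul_pow, mul_div_mul_comm]

lemma pair_moebius (hp : 0 < p) {k k' : ℤ} (h : (p : ℤ) ∣ 1 + 1728 * k * k') {τ : ℂ}
    (hτ : 0 < τ.im) :
    pairS p δ (τ / (1 - 72 * k * τ)) = pairS p δ ((τ + 24 * k') / p) ∧
      pairE p δ (τ / (1 - 72 * k * τ)) = pairE p δ ((τ + 24 * k') / p) := by
  have hpc : (p : ℂ) ≠ 0 := by exact_mod_cast hp.ne'
  obtain ⟨m, hm⟩ := h
  have hmC : 1 + 1728 * (k : ℂ) * k' = p * m := by exact_mod_cast hm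
  have hd1 : (1 : ℤ) * 1 - 3 * 0 * (-24 * k) = 1 := by ring
  have hd2 : (p : ℤ) * m - 3 * (-24 * k') * (-24 * k) = 1 := by linear_combination -hm
  have h1 : τ / (1 - 72 * k * τ) = (((1 : ℤ) : ℂ) * τ + (0 : ℤ)) /
      (3 * (-24 * k : ℤ) * τ + (1 : ℤ)) := by
    push_cast
    ring
  have hσ : 0 < ((τ + 24 * k') / p : ℂ).im := by
    refine im_div_natCast_pos hp ?_
    have : (τ + 24 * k' : ℂ) = τ + ((24 * k' : ℤ) : ℂ) := by push_cast; ring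
    rwa [this, add_im, intCast_im, add_zero]
  have h2 : p * (τ / (1 - 72 * k * τ)) = (((p : ℤ) : ℂ) * ((τ + 24 * k') / p) + (-24 * k' : ℤ)) /
      (3 * (-24 * k : ℤ) * ((τ + 24 * k') / p) + (m : ℤ)) := by
    have e1 : ((p : ℤ) : ℂ) * ((τ + 24 * k') / p) + (-24 * k' : ℤ) = τ := by
      push_cast
      rw [mul_div_cancel₀ _ hpc]
      ring
    have e2 : 3 * ((-24 * k : ℤ) : ℂ) * ((τ + 24 * k') / p) + (m : ℤ) = (1 - 72 * k * τ) / p := by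
      push_cast
      field_simp
      linear_combination -hmC
    rw [e1, e2, div_div_eq_mul_div, mul_comm, mul_comm, mul_div_assoc, mul_comm]
    ring
  have h3 : p * ((τ + 24 * k') / p : ℂ) = τ + ((24 * k' : ℤ) : ℂ) := by
    push_cast
    rw [mul_div_cancel₀ _ hpc]
  have hc : (6 : ℤ) ∣ -24 * k := ⟨-4 * k, by ring⟩
  have hb : (6 : ℤ) ∣ -24 * k' := ⟨-4 * k', by ring⟩
  constructor
  · rw [pairS, pairS, h2, cubicS_moebius hd2 hb hc hσ, h1, cubicS_moebius hd1 (dvd_zero 6) hc hτ,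
      h3, cubicS_add_int, cexp_pi_div_three_zpow_eq (n := 0) (by lia), zpow_zero, one_mul, mul_comm]
  · rw [pairE, pairE, h2, cubicE_moebius hd2 hc hσ, h1, cubicE_moebius hd1 hc hτ,
      h3, cubicE_add_int hτ, mul_comm]

lemma differentiableAt_pairS (hp : 0 < p) {τ : ℂ} (hτ : 0 < τ.im) :
    DifferentiableAt ℂ (pairS p δ) τ :=
  ((differentiableAt_cubicS hτ).mul ((differentiableAt_cubicS (im_natCast_mul_pos hp hτ)).comp τ
    (differentiableAt_id.const_mul _))).pow δ

lemma differentiableAt_pairE (hp : 0 < p) {τ : ℂ} (hτ : 0 < τ.im) :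
    DifferentiableAt ℂ (pairE p δ) τ :=
  ((differentiableAt_cubicE hτ).mul ((differentiableAt_cubicE (im_natCast_mul_pos hp hτ)).comp τ
    (differentiableAt_id.const_mul _))).pow δ

lemma tendsto_natCast_mul_comap_im (hp : 0 < p) :
    Tendsto (fun τ : ℂ => p * τ) (comap im atTop) (comap im atTop) := by
  refine tendsto_comap_iff.mpr ?_
  have : 0 < (p : ℝ) := by exact_mod_cast hp
  refine (tendsto_comap.const_mul_atTop this).congr fun τ => ?_
  rw [Function.comp_apply, ← ofReal_natCast, im_ofReal_mul]

lemma exists_pairE_eq (hp : 0 < p) : ∃ F : ℂ → ℂ, AnalyticAt ℂ F 0 ∧ F 0 = 1 ∧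
    ∀ τ : ℂ, 0 < τ.im → pairE p δ τ = F (cexp (2 * Real.pi * I * τ)) := by
  refine exists_analyticAt_of_periodic (fun τ hτ => differentiableAt_pairE hp hτ)
    (fun τ hτ => pairE_add_one hp hτ) ?_
  have := (tendsto_cubicE.mul (tendsto_cubicE.comp (tendsto_natCast_mul_comap_im hp))).pow δ
  rwa [one_mul, one_pow] at this

lemma exists_pairS_eq (hp : 0 < p) {N : ℕ} (hN : (p + 1) * δ = 6 * N) :
    ∃ F : ℂ → ℂ, AnalyticAt ℂ F 0 ∧ F 0 ≠ 0 ∧ ∀ τ : ℂ, 0 < τ.im →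
      pairS p δ τ = cexp (2 * Real.pi * I * τ) ^ N * F (cexp (2 * Real.pi * I * τ)) := by
  have hne (τ : ℂ) : cexp (2 * Real.pi * I * τ) ^ N ≠ 0 := pow_ne_zero _ (Complex.exp_ne_zero _)
  have hlim : Tendsto (fun τ => pairS p δ τ / cexp (2 * Real.pi * I * τ) ^ N)
      (comap im atTop) (𝓝 (3 ^ δ)) := by
    have h1 := ((tendsto_cubicS_unit.mul
      (tendsto_cubicS_unit.comp (tendsto_natCast_mul_comap_im hp))).pow δ).const_mul (3 ^ δ)
    rw [one_mul, one_pow, mul_one] at h1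
    refine h1.congr fun τ => ?_
    rw [pairS, cubicS_eq, cubicS_eq, eq_div_iff (hne τ)]
    have h2 : cexp (2 * Real.pi * I * τ) ^ N =
        (cexp (Real.pi * I * τ / 3) * cexp (Real.pi * I * (p * τ) / 3)) ^ δ := by
      rw [← Complex.exp_add, ← Complex.exp_nat_mul, ← Complex.exp_nat_mul]
      congr 1
      have : ((p : ℂ) + 1) * δ = 6 * N := by exact_mod_cast hN
      linear_combination -Real.pi * I * τ / 3 * this
    rw [h2, ← sqrt_three_sq, Function.comp_apply]
    ring
  obtain ⟨F, hF, hF0, h⟩ := exists_analyticAt_of_periodic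
    (fun τ hτ => (differentiableAt_pairS (δ := δ) hp hτ).fun_div (by fun_prop) (hne τ))
    (fun τ hτ => by
      rw [pairS_add_one ⟨N, hN⟩, mul_add, mul_one, Complex.exp_periodic]) hlim
  refine ⟨F, hF, hF0 ▸ pow_ne_zero _ three_ne_zero, fun τ hτ => ?_⟩
  rw [← h τ hτ, mul_div_cancel₀ _ (hne τ)]

/-- The key relation: enough monomials of bounded weight in `pairS` and `pairE` are dependent. -/
lemma exists_sum_pair_eq_zero [Fact p.Prime] (hp3 : 3 < p) {N L : ℕ} (hN : (p + 1) * δ = 6 * N)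
    {ι : Type*} [Fintype ι] (i j e : ι → ℕ) (hL : ∀ k, i k + j k + 2 * e k = L)
    (hcard : N * L + 1 < Fintype.card ι) :
    ∃ c : ι → ℂ, c ≠ 0 ∧ ∀ τ : ℂ, 0 < τ.im →
      ∑ k, c k * (pairS p δ τ ^ i k * pairE p δ τ ^ e k) = 0 := by
  have hp : 0 < p := by lia
  obtain ⟨F, hF, hF0, hS⟩ := exists_pairS_eq (δ := δ) hp hN
  obtain ⟨G, hG, -, hE⟩ := exists_pairE_eq (δ := δ) hp
  obtain ⟨c, hc, H, hH, h⟩ := exists_sum_eq_pow_mul hcard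
    (F := fun k q => (q ^ N * F q) ^ i k * G q ^ e k)
    (fun k => (((analyticAt_id.pow N).mul hF).pow _).mul (hG.pow _))
  refine ⟨c, hc, fun τ hτ => ?_⟩
  set f : ℂ → ℂ := fun τ => ∑ k, c k * (pairS p δ τ ^ i k * pairE p δ τ ^ e k) with hf
  set g : ℂ → ℂ := fun τ => ∑ k, c k * (pairS p δ τ ^ j k * pairE p δ τ ^ e k) with hg
  refine eq_zero_of_heckeNorm (f := f) (fh := fun τ => g τ / pairS p δ τ ^ L) hp3
    ?_ ?_ ?_ ?_ ?_ ?_ ?_ hτ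
  · intro τ hτ
    have h1 := differentiableAt_pairS (δ := δ) hp hτ
    have h2 := differentiableAt_pairE (δ := δ) hp hτ
    exact (DifferentiableAt.fun_sum fun k _ =>
      ((h1.pow _).mul (h2.pow _)).const_mul _).differentiableWithinAt
  · intro τ hτ
    have h1 := differentiableAt_pairS (δ := δ) hp hτ
    have h2 := differentiableAt_pairE (δ := δ) hp hτ
    exact ((DifferentiableAt.fun_sum fun k _ => ((h1.pow _).mul (h2.pow _)).const_mul _).fun_div
      (h1.pow L) (pow_ne_zero _ (pairS_ne_zero hp hτ))).differentiableWithinAt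
  · intro τ hτ
    simp only [hf, pairS_add_one ⟨N, hN⟩, pairE_add_one hp hτ]
  · intro τ hτ
    simp only [hg, pairS_add_one ⟨N, hN⟩, pairE_add_one hp hτ]
  · intro τ hτ
    have h0 := pairS_ne_zero (δ := δ) hp (im_div_natCast_pos hp hτ)
    simp only [hf, hg, pairS_fricke hp hτ, pairE_fricke hp hτ]
    rw [Finset.sum_div]
    refine Finset.sum_congr rfl fun k _ => ?_
    rw [← hL k, pow_add, pow_add, pow_mul, div_pow, inv_pow]
    field_simp
  · intro k k' hk τ hτ
    have := pair_moebius (δ := δ) hp hk hτ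
    simp only [hg, this.1, this.2]
  · have hq := tendsto_cexp_two_pi
    have hlim : Tendsto (fun q : ℂ => q * (H q * (∑ k, c k * ((q ^ N * F q) ^ j k * G q ^ e k)) /
        F q ^ L)) (𝓝 0) (𝓝 0) := by
      have hc : ContinuousAt (fun q : ℂ =>
          q * (H q * (∑ k, c k * ((q ^ N * F q) ^ j k * G q ^ e k)) /
        F q ^ L)) 0 := by
        refine ContinuousAt.mul continuousAt_id
          (ContinuousAt.div (ContinuousAt.mul hH.continuousAt ?_)
          (hF.continuousAt.pow L) (pow_ne_zero _ hF0))
        exact tendsto_finsetSum _ fun k _ => ContinuousAt.mul continuousAt_const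
          (((((continuousAt_id (x := (0 : ℂ))).pow N).mul hF.continuousAt).pow _).mul
            (hG.continuousAt.pow _))
      simpa [ContinuousAt] using hc
    refine (hlim.comp hq).congr' ?_
    filter_upwards [preimage_mem_comap (Ioi_mem_atTop 0)] with τ hτ
    have hτ : 0 < τ.im := hτ
    have hfτ := h (cexp (2 * Real.pi * I * τ))
    simp only [← hS τ hτ, ← hE τ hτ] at hfτ
    have hne := pairS_ne_zero (δ := δ) hp hτ
    simp only [Function.comp_apply, ← hS τ hτ, ← hE τ hτ]
    have hfτ' : f τ = _ := hfτ
    rw [← mul_div_assoc, ← mul_div_assoc, hfτ']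
    have hqne := Complex.exp_ne_zero (2 * Real.pi * I * τ)
    have hFne : F (cexp (2 * Real.pi * I * τ)) ≠ 0 := fun h0 => by
      rw [hS τ hτ, h0, mul_zero] at hne
      exact hne rfl
    rw [div_eq_div_iff (pow_ne_zero _ hFne) (pow_ne_zero _ hne)]
    change cexp (2 * Real.pi * I * τ) * (H (cexp (2 * Real.pi * I * τ)) * g τ) * _ = _
    rw [hS τ hτ]
    ring

end Pair

section Real

lemma exists_real_hasProd_eulerProd {q : ℝ} (hq0 : 0 < q) (hq1 : q < 1) :
    ∃ r : ℝ, r ≠ 0 ∧ HasProd (fun n : ℕ => 1 - q ^ (n + 1)) r ∧ eulerProd q = r := by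
  have hlt (n : ℕ) : q ^ (n + 1) < 1 := pow_lt_one₀ hq0.le hq1 n.succ_ne_zero
  have hs : Summable fun n : ℕ => -q ^ (n + 1) :=
    ((summable_nat_add_iff 1).mpr (summable_geometric_of_lt_one hq0.le hq1)).neg
  have hm : Multipliable fun n : ℕ => 1 - q ^ (n + 1) := by
    simpa [sub_eq_add_neg] using Real.multipliable_one_add_of_summable hs
  refine ⟨_, ?_, hm.hasProd, ?_⟩
  · have := tprod_one_add_ne_zero_of_summable (f := fun n : ℕ => -q ^ (n + 1))
      (fun n => by have := hlt n; intro h; linarith) (by simpa using hs.norm)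
    simpa [sub_eq_add_neg] using this
  · have := hm.hasProd.map ofRealHom continuous_ofReal
    rw [ofRealHom_eq_coe] at this
    rw [eulerProd, ← this.tprod_eq]
    simp

lemma exists_real_jacobiTheta {y : ℝ} : ∃ r : ℝ, jacobiTheta (I * y) = r := by
  refine ⟨∑' n : ℤ, Real.exp (-Real.pi * n ^ 2 * y), ?_⟩
  rw [jacobiTheta, ofReal_tsum]
  refine tsum_congr fun n => ?_
  push_cast
  congr 1
  linear_combination (Real.pi * n ^ 2 * y : ℂ) * I_sq

lemma exists_real_cubicTheta (y : ℝ) : ∃ r : ℝ, cubicTheta (I * y) = r := by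
  have h (c : ℝ) : ∃ r : ℝ, jacobiTheta ((c : ℝ) * (I * y)) = r := by
    obtain ⟨r, hr⟩ := exists_real_jacobiTheta (y := c * y)
    refine ⟨r, ?_⟩
    rw [← hr]
    push_cast
    ring_nf
  obtain ⟨r1, h1⟩ := h 2
  obtain ⟨r2, h2⟩ := h 6
  obtain ⟨r3, h3⟩ := h (1 / 2)
  obtain ⟨r4, h4⟩ := h (3 / 2)
  exact ⟨r1 * r2 + (r3 - r1) * (r4 - r2), by rw [cubicTheta_eq, h1, h2, h3, h4]; push_cast; rfl⟩

lemma cexp_two_pi_I_mul_I (y : ℝ) :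
    cexp (2 * Real.pi * I * (I * y)) = (Real.exp (-2 * Real.pi * y) : ℝ) := by
  push_cast
  congr 1
  linear_combination (2 * Real.pi * y : ℂ) * I_sq

/-- The values of `cubicS`, `cubicE` on the imaginary axis and their relation with `x₃`. -/
lemma exists_real_cubic {y : ℝ} (hy : 0 < y) : ∃ s e : ℝ, 0 < s ∧ 0 < e ∧ cubicS (I * y) = s ∧
    cubicE (I * y) = e ∧ e ^ 3 = 1 + s ^ 6 ∧
    x₃ (Real.exp (-2 * Real.pi * y)) = s ^ 6 / e ^ 3 := by
  set q := Real.exp (-2 * Real.pi * y) with hq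
  have hqC := cexp_two_pi_I_mul_I y
  rw [← hq] at hqC
  have hq0 : 0 < q := Real.exp_pos _
  have hq1 : q < 1 := by
    rw [hq, Real.exp_lt_one_iff]
    nlinarith [Real.pi_pos, mul_pos Real.pi_pos hy]
  have hq3 : q ^ 3 < 1 := pow_lt_one₀ hq0.le hq1 three_ne_zero
  obtain ⟨a, ha0, ha, haC⟩ := exists_real_hasProd_eulerProd hq0 hq1
  obtain ⟨b, hb0, hb, hbC⟩ := exists_real_hasProd_eulerProd (pow_pos hq0 3) hq3
  push_cast at hbC
  obtain ⟨t, ht⟩ := exists_real_cubicTheta y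
  have him : 0 < (I * (y : ℂ)).im := by simpa using hy
  have hS : cubicS (I * y) = (√3 * Real.exp (-Real.pi * y / 3) * (b / a) ^ 2 : ℝ) := by
    rw [cubicS_eq, hqC, haC, hbC]
    push_cast
    congr 3
    linear_combination (Real.pi * y / 3 : ℂ) * I_sq
  have hE : cubicE (I * y) = (t * (b / a ^ 3) : ℝ) := by
    rw [cubicE_eq, hqC, haC, hbC, ht]
    push_cast
    rfl
  have h6 : (√3 * Real.exp (-Real.pi * y / 3) * (b / a) ^ 2) ^ 6 = 27 * q * (b / a) ^ 12 := by
    have := cubicS_pow_six_eq (I * y)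
    rw [hS, hqC, haC, hbC] at this
    exact_mod_cast this
  have h3 := cubicE_pow_three him
  rw [hE, hS] at h3
  have h3' : (t * (b / a ^ 3)) ^ 3 = 1 + (√3 * Real.exp (-Real.pi * y / 3) * (b / a) ^ 2) ^ 6 := by
    exact_mod_cast h3
  have hs0 : 0 < √3 * Real.exp (-Real.pi * y / 3) * (b / a) ^ 2 := by positivity
  refine ⟨_, _, hs0, ?_, hS, hE, h3', ?_⟩
  · refine (Odd.pow_pos_iff (n := 3) (by decide)).mp ?_
    rw [h3']
    positivity
  · have hP : ∏' n : ℕ, (1 + q ^ (n + 1) + q ^ (2 * (n + 1))) ^ (-12 : ℤ) = (a / b) ^ 12 := by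
      rw [← ((ha.div₀ hb hb0).pow 12).tprod_eq]
      refine tprod_congr fun n => ?_
      have hx : q ^ (n + 1) < 1 := pow_lt_one₀ hq0.le hq1 n.succ_ne_zero
      have hx0 : 0 < q ^ (n + 1) := pow_pos hq0 _
      rw [pow_mul', pow_right_comm q 3]
      generalize q ^ (n + 1) = x at hx hx0
      have e1 : 1 - x ≠ 0 := by linarith
      have e2 : 1 + x + x ^ 2 ≠ 0 := by positivity
      have e3 : (1 - x) / (1 - x ^ 3) = (1 + x + x ^ 2)⁻¹ := by
        rw [show 1 - x ^ 3 = (1 - x) * (1 + x + x ^ 2) by ring]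
        field_simp
      rw [e3, inv_pow, zpow_neg]
      rfl
    rw [x₃, hP, h3', h6]
    field_simp
    ring

/-- The values of `pairS`, `pairE` on the imaginary axis and their relation with `x₃`. -/
lemma exists_real_pair {p δ h : ℕ} (hp : 0 < p) (hδ : δ * h = 6) {y : ℝ} (hy : 0 < y) :
    ∃ s W : ℝ, 1 < W ∧ pairS p δ (I * y) = s ∧ pairE p δ (I * y) = (W ^ 2 : ℝ) ∧
      (x₃ (Real.exp (-2 * Real.pi * y) ^ p) * x₃ (Real.exp (-2 * Real.pi * y))) ^ ((1 : ℝ) / h) =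
        s / W ∧
      ((1 - x₃ (Real.exp (-2 * Real.pi * y) ^ p)) * (1 - x₃ (Real.exp (-2 * Real.pi * y)))) ^
        ((1 : ℝ) / h) = 1 / W := by
  have hpR : 0 < (p : ℝ) := by exact_mod_cast hp
  obtain ⟨s, e, hs, he, hsC, heC, h1, hx⟩ := exists_real_cubic hy
  obtain ⟨s', e', hs', he', hsC', heC', h1', hx'⟩ := exists_real_cubic (mul_pos hpR hy)
  have hexp : Real.exp (-2 * Real.pi * (p * y)) = Real.exp (-2 * Real.pi * y) ^ p := by
    rw [← Real.exp_nat_mul]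
    ring_nf
  have hC : (p : ℂ) * (I * y) = I * ((p * y : ℝ) : ℂ) := by push_cast; ring
  rw [hexp] at hx'
  have hh : h ≠ 0 := by rintro rfl; simp at hδ
  have hδ0 : δ ≠ 0 := by rintro rfl; simp at hδ
  have hgt {s e : ℝ} (hs : 0 < s) (he : 0 < e) (h : e ^ 3 = 1 + s ^ 6) : 1 < e := by
    refine lt_of_pow_lt_pow_left₀ 3 he.le ?_
    rw [h, one_pow]
    exact lt_add_of_pos_right _ (by positivity)
  have hee : 1 < e * e' := one_lt_mul_of_lt_of_le (hgt hs he h1) (hgt hs' he' h1').le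
  have hee0 : 0 < e * e' := by positivity
  have hW2 : √((e * e') ^ δ) ^ 2 = (e * e') ^ δ := Real.sq_sqrt (by positivity)
  have hW0 : 0 < √((e * e') ^ δ) := by positivity
  have hWh : √((e * e') ^ δ) ^ h = (e * e') ^ 3 := by
    refine (pow_left_inj₀ (by positivity) (by positivity) two_ne_zero).mp ?_
    rw [pow_right_comm, hW2, ← pow_mul, hδ, ← pow_mul]
  refine ⟨(s * s') ^ δ, √((e * e') ^ δ), ?_, ?_, ?_, ?_, ?_⟩
  · rw [Real.lt_sqrt zero_le_one, one_pow]
    exact one_lt_pow₀ hee hδ0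
  · rw [pairS, hC, hsC, hsC']
    push_cast
    rfl
  · rw [pairE, hC, heC, heC', hW2]
    push_cast
    rfl
  · rw [one_div, ← Real.pow_rpow_inv_natCast (x := (s * s') ^ δ / _) (by positivity) hh, div_pow,
      hWh, ← pow_mul, hδ, hx, hx']
    congr 1
    field_simp
  · have h2 : 1 - x₃ (Real.exp (-2 * Real.pi * y)) = 1 / e ^ 3 := by
      rw [hx, eq_div_iff (by positivity), sub_mul, div_mul_cancel₀ _ (by positivity), h1]
      ring
    have h2' : 1 - x₃ (Real.exp (-2 * Real.pi * y) ^ p) = 1 / e' ^ 3 := by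
      rw [hx', eq_div_iff (by positivity), sub_mul, div_mul_cancel₀ _ (by positivity), h1']
      ring
    nth_rw 1 [one_div (h : ℝ)]
    rw [← Real.pow_rpow_inv_natCast (x := 1 / √((e * e') ^ δ)) (by positivity) hh, div_pow,
      hWh, h2, h2', one_pow]
    congr 1
    field_simp

end Real

section Equation

/-- A complex linear relation between monomials with real arguments yields a real one. -/
lemma exists_real_mvPolynomial {ι σ : Type*} [Fintype ι] [Fintype σ] {m : ι → σ →₀ ℕ}
    (hm : Function.Injective m) {c : ι → ℂ} (hc : c ≠ 0) :
    ∃ P : MvPolynomial σ ℝ, P ≠ 0 ∧ (∀ a n, (∀ k, m k a ≤ n) → P.degreeOf a ≤ n) ∧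
      ∀ x : σ → ℝ, ∑ k, c k * ((∏ a, x a ^ m k a : ℝ) : ℂ) = 0 → MvPolynomial.eval x P = 0 := by
  classical
  obtain ⟨l, hl⟩ := Function.ne_iff.mp hc
  let r : ι → ℝ := fun k => ((starRingEnd ℂ) (c l) * c k).re
  refine ⟨∑ k, MvPolynomial.monomial (m k) (r k), ?_, ?_, ?_⟩
  · intro h0
    have h := congrArg (MvPolynomial.coeff (m l)) h0
    simp only [MvPolynomial.coeff_sum, MvPolynomial.coeff_monomial, hm.eq_iff,
      MvPolynomial.coeff_zero, Finset.sum_ite_eq', Finset.mem_univ, if_true] at h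
    have hn : ((starRingEnd ℂ) (c l) * c l).re = normSq (c l) := by
      rw [mul_comm, mul_conj, ofReal_re]
    exact hl (normSq_eq_zero.mp (hn ▸ h))
  · intro a n hn
    refine (MvPolynomial.degreeOf_sum_le a _ _).trans (Finset.sup_le fun k _ => ?_)
    rcases eq_or_ne (r k) 0 with h | h
    · simp [h]
    · rw [MvPolynomial.degreeOf_monomial_eq _ _ h]
      exact hn k
  · intro x hx
    have h : (∑ k, (starRingEnd ℂ) (c l) * (c k * ((∏ a, x a ^ m k a : ℝ) : ℂ))).re = 0 := by
      rw [← Finset.mul_sum, hx, mul_zero, zero_re]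
    rw [map_sum, ← h, re_sum]
    refine Finset.sum_congr rfl fun k _ => ?_
    rw [MvPolynomial.eval_monomial, ← mul_assoc, re_mul_ofReal, Finsupp.prod_fintype _ _ (by simp)]

/-- The function `(αβ)^{1/h}` at `q = e^{-2πy}`. -/
noncomputable def modularU (p h : ℕ) (y : ℝ) : ℝ :=
  (x₃ (Real.exp (-2 * Real.pi * y) ^ p) * x₃ (Real.exp (-2 * Real.pi * y))) ^ ((1 : ℝ) / h)

/-- The function `((1-α)(1-β))^{1/h}` at `q = e^{-2πy}`. -/
noncomputable def modularV (p h : ℕ) (y : ℝ) : ℝ :=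
  ((1 - x₃ (Real.exp (-2 * Real.pi * y) ^ p)) * (1 - x₃ (Real.exp (-2 * Real.pi * y)))) ^
    ((1 : ℝ) / h)

variable {p δ h : ℕ}

lemma exists_eval_modular_eq_zero [Fact p.Prime] (hp3 : 3 < p) {N L : ℕ}
    (hN : (p + 1) * δ = 6 * N) (hδ : δ * h = 6) {ι : Type*} [Fintype ι] (i j : ι → ℕ)
    (hL : ∀ k, ∃ e, i k + j k + 2 * e = L) (hcard : N * L + 1 < Fintype.card ι)
    (hij : ∀ k l, i k = i l → j k = j l → k = l) :
    ∃ P : MvPolynomial (Fin 2) ℝ, P ≠ 0 ∧ (∀ n, (∀ k, i k ≤ n) → P.degreeOf 0 ≤ n) ∧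
      (∀ n, (∀ k, j k ≤ n) → P.degreeOf 1 ≤ n) ∧
      ∀ y, 0 < y → MvPolynomial.eval ![modularU p h y, modularV p h y] P = 0 := by
  choose e he using hL
  obtain ⟨c, hc, hrel⟩ := exists_sum_pair_eq_zero hp3 hN i j e he hcard
  let m : ι → Fin 2 →₀ ℕ := fun k => Finsupp.equivFunOnFinite.symm ![i k, j k]
  have hm : Function.Injective m := fun k l hkl =>
    hij k l (DFunLike.congr_fun hkl 0) (DFunLike.congr_fun hkl 1)
  obtain ⟨P, hP, hdeg, heval⟩ := exists_real_mvPolynomial hm hc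
  refine ⟨P, hP, hdeg 0, hdeg 1, fun y hy => heval _ ?_⟩
  obtain ⟨s, W, hW, hS, hE, hU, hV⟩ := exists_real_pair (Fact.out : p.Prime).pos hδ hy
  have hW0 : (W : ℂ) ≠ 0 := by exact_mod_cast (by positivity : W ≠ 0)
  have hterm (k : ι) : c k * ((∏ a, ![modularU p h y, modularV p h y] a ^ m k a : ℝ) : ℂ) =
      ((W : ℂ) ^ L)⁻¹ * (c k * (pairS p δ (I * y) ^ i k * pairE p δ (I * y) ^ e k)) := by
    have h0 : m k 0 = i k := rfl
    have h1 : m k 1 = j k := rfl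
    rw [Fin.prod_univ_two, h0, h1, Matrix.cons_val_zero, Matrix.cons_val_one, Matrix.cons_val_zero,
      modularU, modularV, hU, hV, hS, hE, ← he k]
    push_cast
    rw [div_pow, div_pow, one_pow, ← pow_mul, pow_add, pow_add]
    field_simp
  rw [Finset.sum_congr rfl fun k _ => hterm k, ← Finset.mul_sum, hrel _ (by simpa using hy),
    mul_zero]

lemma exists_modular_degreeOf_le [Fact p.Prime] (hp3 : 3 < p) {N : ℕ}
    (hN : (p + 1) * δ = 6 * N) (hδ : δ * h = 6) :
    (∃ P : MvPolynomial (Fin 2) ℝ, (∀ y, 0 < y →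
      MvPolynomial.eval ![modularU p h y, modularV p h y] P = 0) ∧ P ≠ 0 ∧ P.degreeOf 0 ≤ 2 * N) ∧
    (∃ P : MvPolynomial (Fin 2) ℝ, (∀ y, 0 < y →
      MvPolynomial.eval ![modularU p h y, modularV p h y] P = 0) ∧
      P ≠ 0 ∧ P.degreeOf 1 ≤ 2 * N) := by
  let M := 2 * N ^ 2 + 2
  let ι := Fin (2 * N + 1) × Fin M
  let i : ι → ℕ := fun k => k.1
  let j : ι → ℕ := fun k => 2 * k.2 + k.1 % 2
  have hi (k : ι) : i k ≤ 2 * N := Nat.lt_succ_iff.mp k.1.2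
  have hL (k : ι) : ∃ e, i k + j k + 2 * e = 2 * N + 2 * M := by
    have h1 := k.1.2
    have h2 := k.2.2
    exact ⟨(2 * N + 2 * M - i k - j k) / 2, by simp only [i, j]; omega⟩
  have hcard : N * (2 * N + 2 * M) + 1 < Fintype.card ι := by
    simp only [ι, M, Fintype.card_prod, Fintype.card_fin]
    nlinarith
  have hij (k l : ι) (h1 : i k = i l) (h2 : j k = j l) : k = l := by
    have h3 : (k.1 : ℕ) = l.1 := h1
    have h4 : 2 * (k.2 : ℕ) + k.1 % 2 = 2 * l.2 + l.1 % 2 := h2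
    exact Prod.ext (Fin.ext h3) (Fin.ext (by omega))
  constructor
  · obtain ⟨P, hP, h0, -, he⟩ := exists_eval_modular_eq_zero hp3 hN hδ i j hL hcard hij
    exact ⟨P, he, hP, h0 _ hi⟩
  · obtain ⟨P, hP, -, h1, he⟩ := exists_eval_modular_eq_zero hp3 hN hδ j i
      (fun k => by simpa only [add_comm (j k)] using hL k) hcard fun k l h1 h2 => hij k l h2 h1
    exact ⟨P, he, hP, h1 _ hi⟩

lemma analyticAt_re_comp_I_mul {f : ℂ → ℂ} (hf : ∀ τ : ℂ, 0 < τ.im → DifferentiableAt ℂ f τ)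
    {y : ℝ} (hy : 0 < y) : AnalyticAt ℝ (fun t : ℝ => (f (I * t)).re) y := by
  have hU : IsOpen {τ : ℂ | 0 < τ.im} := isOpen_lt continuous_const continuous_im
  have h1 : AnalyticAt ℂ f (I * y) := DifferentiableOn.analyticAt
    (fun τ hτ => (hf τ hτ).differentiableWithinAt) (hU.mem_nhds (by simpa using hy))
  have h2 : AnalyticAt ℝ (fun t : ℝ => I * (t : ℂ)) y :=
    analyticAt_const.mul (ofRealCLM.analyticAt y)
  have h3 : AnalyticAt ℝ (fun t : ℝ => f (I * t)) y :=
    (h1.restrictScalars (𝕜 := ℝ)).comp_of_eq h2 rfl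
  exact (reCLM.analyticAt _).comp_of_eq h3 rfl

lemma analyticOnNhd_modular (hp : 0 < p) (hδ : δ * h = 6) :
    AnalyticOnNhd ℝ (modularU p h) (Set.Ioi 0) ∧ AnalyticOnNhd ℝ (modularV p h) (Set.Ioi 0) := by
  have hE (y : ℝ) (hy : 0 < y) : 0 < (pairE p δ (I * y)).re := by
    obtain ⟨s, W, hW, -, hE, -⟩ := exists_real_pair hp hδ hy
    rw [hE, ofReal_re]
    positivity
  have hW : AnalyticOnNhd ℝ (fun t : ℝ => √(pairE p δ (I * t)).re) (Set.Ioi 0) := fun y hy => by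
    have h1 : AnalyticAt ℝ Real.sqrt (pairE p δ (I * y)).re :=
      (Real.contDiffAt_sqrt (hE y hy).ne').analyticAt
    exact h1.comp_of_eq (analyticAt_re_comp_I_mul (fun τ => differentiableAt_pairE hp) hy) rfl
  have hW0 (y : ℝ) (hy : y ∈ Set.Ioi (0 : ℝ)) : √(pairE p δ (I * y)).re ≠ 0 :=
    (Real.sqrt_pos.mpr (hE y hy)).ne'
  have hS : AnalyticOnNhd ℝ (fun t : ℝ => (pairS p δ (I * t)).re) (Set.Ioi 0) := fun y hy =>
    analyticAt_re_comp_I_mul (fun τ => differentiableAt_pairS hp) hy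
  constructor
  · refine (hS.div hW hW0).congr isOpen_Ioi fun y hy => ?_
    obtain ⟨s, W, hW, hS, hE, hU, -⟩ := exists_real_pair hp hδ hy
    simp only [modularU]
    rw [hU, hS, hE, ofReal_re, ofReal_re, Real.sqrt_sq (by linarith)]
  · refine ((analyticOnNhd_const (v := (1 : ℝ))).div hW hW0).congr isOpen_Ioi fun y hy => ?_
    obtain ⟨s, W, hW, -, hE, -, hV⟩ := exists_real_pair hp hδ hy
    simp only [modularV]
    rw [hV, hE, ofReal_re, Real.sqrt_sq (by linarith)]

lemma analyticOnNhd_eval {f g : ℝ → ℝ} {U : Set ℝ} (hf : AnalyticOnNhd ℝ f U)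
    (hg : AnalyticOnNhd ℝ g U) (P : MvPolynomial (Fin 2) ℝ) :
    AnalyticOnNhd ℝ (fun y => MvPolynomial.eval ![f y, g y] P) U := by
  simp only [MvPolynomial.eval_eq', Fin.prod_univ_two, Matrix.cons_val_zero, Matrix.cons_val_one]
  exact Finset.analyticOnNhd_fun_sum _ fun m _ =>
    analyticOnNhd_const.mul ((hf.pow _).mul (hg.pow _))

lemma infinite_image_modularV (hp : 0 < p) (hδ : δ * h = 6) :
    (modularV p h '' Set.Ioi 0).Infinite := by
  intro hfin
  obtain ⟨F, hF, hF0, hFE⟩ := exists_pairE_eq (δ := δ) hp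
  have hI : Tendsto (fun y : ℝ => I * (y : ℂ)) atTop (comap im atTop) :=
    tendsto_comap_iff.mpr (tendsto_id.congr fun y => by simp)
  have hE : Tendsto (fun y : ℝ => 1 / √(pairE p δ (I * y)).re) atTop (𝓝 1) := by
    have h1 : Tendsto (fun y : ℝ => F (cexp (2 * Real.pi * I * (I * y)))) atTop (𝓝 1) :=
      hF0 ▸ hF.continuousAt.tendsto.comp (tendsto_cexp_two_pi.comp hI)
    have h2 : Tendsto (fun y : ℝ => pairE p δ (I * y)) atTop (𝓝 1) := by
      refine h1.congr' ?_
      filter_upwards [eventually_gt_atTop 0] with y hy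
      exact (hFE _ (by simpa using hy)).symm
    have h3 := (continuous_re.tendsto 1).comp h2
    have h4 := (Real.continuous_sqrt.tendsto _).comp h3
    simpa [Function.comp_def] using h4.inv₀ (by simp)
  have hV : Tendsto (modularV p h) atTop (𝓝 1) := by
    refine hE.congr' ?_
    filter_upwards [eventually_gt_atTop 0] with y hy
    obtain ⟨s, W, hW, -, hE, -, hV⟩ := exists_real_pair hp hδ hy
    rw [modularV, hV, hE, ofReal_re, Real.sqrt_sq (by linarith)]
  obtain ⟨y, hy, hy1⟩ := hfin.isClosed.mem_of_tendsto hV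
    ((eventually_gt_atTop 0).mono fun y hy => Set.mem_image_of_mem _ hy)
  obtain ⟨s, W, hW, -, -, -, hV⟩ := exists_real_pair hp hδ hy
  rw [modularV, hV, div_eq_one_iff_eq (by positivity)] at hy1
  exact hW.ne hy1

/-- The ideal of polynomials vanishing along a plane curve. -/
def curveIdeal (f g : ℝ → ℝ) (U : Set ℝ) : Ideal (MvPolynomial (Fin 2) ℝ) where
  carrier := {P | ∀ y ∈ U, MvPolynomial.eval ![f y, g y] P = 0}
  add_mem' hP hQ y hy := by rw [map_add, hP y hy, hQ y hy, add_zero]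
  zero_mem' y _ := map_zero _
  smul_mem' c P hP y hy := by rw [smul_eq_mul, map_mul, hP y hy, mul_zero]

lemma curveIdeal_isPrime {f g : ℝ → ℝ} {U : Set ℝ} (hf : AnalyticOnNhd ℝ f U)
    (hg : AnalyticOnNhd ℝ g U) (hU : IsPreconnected U) (hne : U.Nonempty) :
    (curveIdeal f g U).IsPrime := by
  refine ⟨fun h => ?_, fun {P Q} hPQ => ?_⟩
  · obtain ⟨y, hy⟩ := hne
    have h1 : (1 : MvPolynomial (Fin 2) ℝ) ∈ curveIdeal f g U := h ▸ Submodule.mem_top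
    exact one_ne_zero ((map_one _).symm.trans (h1 y hy))
  · exact (analyticOnNhd_eval hf hg P).eq_zero_or_eq_zero_of_mul_eq_zero
      (analyticOnNhd_eval hf hg Q)
      (fun y hy => (map_mul _ P Q).symm.trans (hPQ y hy)) hU

lemma eq_zero_of_mem_curveIdeal {f g : ℝ → ℝ} {U : Set ℝ} (hg : (g '' U).Infinite)
    {P : MvPolynomial (Fin 2) ℝ} (hP : P ∈ curveIdeal f g U) (hdeg : P.degreeOf 0 = 0) : P = 0 := by
  refine MvPolynomial.funext_set ![Set.univ, g '' U] (fun a => ?_) fun x hx => ?_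
  · fin_cases a
    · exact Set.infinite_univ
    · exact hg
  · obtain ⟨y, hy, hxy⟩ := hx 1 (Set.mem_univ _)
    rw [map_zero, ← hP y hy, MvPolynomial.eval_eq', MvPolynomial.eval_eq']
    refine Finset.sum_congr rfl fun m hm => ?_
    have h0 : m 0 = 0 := Nat.le_zero.mp (hdeg ▸ MvPolynomial.le_degreeOf_of_mem_support 0 hm)
    simp [Fin.prod_univ_two, h0, hxy]

lemma exists_modular_equation [Fact p.Prime] (hp3 : 3 < p) {N : ℕ}
    (hN : (p + 1) * δ = 6 * N) (hδ : δ * h = 6) :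
    ∃ P : MvPolynomial (Fin 2) ℝ, P ≠ 0 ∧ P.degreeOf 0 ≤ 2 * N ∧ P.degreeOf 1 ≤ 2 * N ∧
      ∀ y, 0 < y → MvPolynomial.eval ![modularU p h y, modularV p h y] P = 0 := by
  have hp : 0 < p := (Fact.out : p.Prime).pos
  obtain ⟨hU, hV⟩ := analyticOnNhd_modular hp hδ
  have hprime := curveIdeal_isPrime hU hV isPreconnected_Ioi ⟨1, Set.mem_Ioi.mpr one_pos⟩
  obtain ⟨h0, h1⟩ := exists_modular_degreeOf_le hp3 hN hδ
  obtain ⟨P, hP, hne, hd0, hd1⟩ := exists_mem_degreeOf_le_of_prime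
    (fun P hP => eq_zero_of_mem_curveIdeal (infinite_image_modularV hp hδ) hP) h0 h1
  exact ⟨P, hne, hd0, hd1, hP⟩

end Equation

end CubicModularForms

/-- Chan–Liaw's theorem for level 3: if `p > 3` is a prime and `(p+1)/3 = n/d` in lowest
terms, `h = 6/d`, then there is a nonzero modular equation `P(u,v) = 0` of degree at most
`n` in each variable, where `u = (αβ)^{1/h}`, `v = ((1-α)(1-β))^{1/h}`, `β = x₃(q)`,
`α = x₃(q^p)`. -/
theorem chan_liaw_level_three (p : ℕ) (hp : p.Prime) (hp3 : 3 < p)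
    (n d h : ℕ)
    (hn : (n : ℤ) = (((p : ℚ) + 1) / 3).num) (hd : d = (((p : ℚ) + 1) / 3).den)
    (hh : h = 6 / d) :
    ∃ P : MvPolynomial (Fin 2) ℝ, P ≠ 0 ∧
      P.degreeOf 0 ≤ n ∧ P.degreeOf 1 ≤ n ∧
      ∀ q : ℝ, 0 < q → q < 1 →
        MvPolynomial.eval
          ![(x₃ (q ^ p) * x₃ q) ^ ((1 : ℝ) / h),
            ((1 - x₃ (q ^ p)) * (1 - x₃ q)) ^ ((1 : ℝ) / h)] P = 0 := by
  have : Fact p.Prime := ⟨hp⟩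
  have hodd : p % 2 = 1 := hp.eq_two_or_odd.resolve_left (by omega)
  have hnd : (p + 1) * d = 3 * n := by
    have h1 := Rat.num_div_den (((p : ℚ) + 1) / 3)
    have hd0 : (d : ℚ) ≠ 0 := hd ▸ Nat.cast_ne_zero.mpr (Rat.den_nz _)
    rw [← hn, ← hd, Int.cast_natCast, div_eq_div_iff hd0 three_ne_zero] at h1
    have h2 : (n : ℚ) * 3 = (p + 1) * d := h1
    have h3 : n * 3 = (p + 1) * d := by exact_mod_cast h2
    omega
  have hd3 : d ∣ 3 := by
    have h1 : (((p : ℚ) + 1) / 3) = Rat.divInt (p + 1 : ℤ) (3 : ℤ) := by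
      rw [Rat.divInt_eq_div]
      push_cast
      rfl
    have h2 := Rat.den_dvd (p + 1 : ℤ) (3 : ℤ)
    rw [← h1, ← hd] at h2
    exact_mod_cast h2
  have hdh : d * h = 6 := hh ▸ Nat.mul_div_cancel' (hd3.trans (by norm_num))
  obtain ⟨N, hN⟩ : 2 ∣ n := by
    have h1 : 2 ∣ 3 * n := hnd ▸ Dvd.dvd.mul_right (by omega) d
    omega
  obtain ⟨P, hP, h0, h1, hev⟩ :=
    exists_modular_equation hp3 (N := N) (by rw [hnd, hN]; ring) hdh
  refine ⟨P, hP, hN ▸ h0, hN ▸ h1, fun q hq0 hq1 => ?_⟩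
  have hq : Real.exp (-2 * Real.pi * (-Real.log q / (2 * Real.pi))) = q := by
    rw [show -2 * Real.pi * (-Real.log q / (2 * Real.pi)) = Real.log q by
      field_simp [Real.pi_ne_zero], Real.exp_log hq0]
  have := hev (-Real.log q / (2 * Real.pi))
    (div_pos (neg_pos.mpr (Real.log_neg hq0 hq1)) Real.two_pi_pos)
  rwa [modularU, modularV, hq] at this
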